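/- arXiv:1510.01956 — 2 statements merged into one kernel-verified Lean document; each statement's English description precedes it below -/
import Mathlib

section
/- Assume F(∞) := lim_{r→∞} F(r) = ∞. Then there exists a radial solution (u₁,u₂) of the system with central value (a₁,a₂), i.e. a pair of continuous functions u₁,u₂ : [0,∞) → ℝ satisfying u₁(r) = a₁ + ∫₀^r (B₁⁻(y)·∫₀^y B₁⁺(t) f₁(u₁(t),u₂(t)) dt)^{1/k₁} dy and u₂(r) = a₂ + ∫₀^r (B₂⁻(y)·∫₀^y B₂⁺(t) f₂(u₁(t),u₂(t)) dt)^{1/k₂} dy for all r ≥ 0; moreover u₁ and u₂ are nondecreasing on [0,∞). -/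
open Real Filter MeasureTheory Set

noncomputable section

/-- A pair `(u₁, u₂)` of continuous functions on `[0, ∞)` is a radial solution of the
`(k₁,k₂)`-Hessian system with convection term, with central value `(a₁, a₂)`, in the
radial integral formulation. -/
def IsRadialSolution (k₁ k₂ : ℕ) (a₁ a₂ : ℝ)
    (B₁m B₁p B₂m B₂p : ℝ → ℝ) (f₁ f₂ : ℝ → ℝ → ℝ) (u₁ u₂ : ℝ → ℝ) : Prop :=
  ContinuousOn u₁ (Set.Ici 0) ∧ ContinuousOn u₂ (Set.Ici 0) ∧
  (∀ r ∈ Set.Ici (0:ℝ),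
    u₁ r = a₁ + ∫ y in (0:ℝ)..r,
      (B₁m y * ∫ t in (0:ℝ)..y, B₁p t * f₁ (u₁ t) (u₂ t)) ^ (1/(k₁:ℝ))) ∧
  (∀ r ∈ Set.Ici (0:ℝ),
    u₂ r = a₂ + ∫ y in (0:ℝ)..r,
      (B₂m y * ∫ t in (0:ℝ)..y, B₂p t * f₂ (u₁ t) (u₂ t)) ^ (1/(k₂:ℝ)))

/-- Knaster–Tarski on a subset of a partial order whose nonempty subsets have suprema in it. -/
theorem exists_fixedPoint_of_monotoneOn {X : Type*} [PartialOrder X]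
    {S : Set X} {T : X → X} (hT : MapsTo T S S) (hmono : MonotoneOn T S)
    (hS : ∀ A ⊆ S, A.Nonempty → ∃ x ∈ S, IsLUB A x)
    {x₀ : X} (hx₀ : x₀ ∈ S) (hle : x₀ ≤ T x₀) : ∃ x ∈ S, T x = x := by
  obtain ⟨x, hmem, hlub⟩ := hS {x | x ∈ S ∧ x ≤ T x} (fun x hx => hx.1) ⟨x₀, hx₀, hle⟩
  have h1 : x ≤ T x := hlub.2 fun v hv => hv.2.trans (hmono hv.1 hmem (hlub.1 hv))
  exact ⟨x, hmem, le_antisymm (hlub.1 ⟨hT hmem, hmono hmem (hT hmem) h1⟩) h1⟩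

/-- Global solution of the separable equation `W' = H(W) q`, `W(0) = a`, when `∫ 1 / H` diverges. -/
theorem exists_separable_solution {a : ℝ} {H q : ℝ → ℝ} (hH : Continuous H)
    (hH0 : ∀ t, 0 < H t) (hHa : ∀ t ≤ a, H t = H a)
    (hdiv : Tendsto (fun r => ∫ t in a..r, 1 / H t) atTop atTop)
    (hq : Continuous q) :
    ∃ W : ℝ → ℝ, Continuous W ∧ ∀ r, W r = a + ∫ y in (0:ℝ)..r, H (W y) * q y := by
  have hc : Continuous fun t => 1 / H t := continuous_const.div hH fun t => (hH0 t).ne'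
  set G : ℝ → ℝ := fun r => ∫ t in a..r, 1 / H t with hG
  have hGd : ∀ r, HasDerivAt G (1 / H r) r := fun r =>
    intervalIntegral.integral_hasDerivAt_right (hc.intervalIntegrable _ _)
      (hc.stronglyMeasurableAtFilter _ _) hc.continuousAt
  have hGc : Continuous G := continuous_iff_continuousAt.2 fun r => (hGd r).continuousAt
  have hGm : StrictMono G := strictMono_of_deriv_pos fun r => by
    rw [(hGd r).deriv]; exact one_div_pos.2 (hH0 r)
  have hbot : Tendsto G atBot atBot := by
    have h1 : Tendsto (fun r : ℝ => (r - a) * (1 / H a)) atBot atBot :=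
      (tendsto_atBot_add_const_right _ (-a) tendsto_id).atBot_mul_const (one_div_pos.2 (hH0 a))
    refine h1.congr' ?_
    filter_upwards [eventually_le_atBot a] with r hr
    have : ∫ t in a..r, 1 / H t = ∫ t in a..r, 1 / H a := by
      refine intervalIntegral.integral_congr fun t ht => ?_
      rw [uIcc_of_ge hr] at ht
      simp only [hHa t ht.2]
    rw [hG]; simp only [this, intervalIntegral.integral_const, smul_eq_mul]
  have hsurj : Function.Surjective G := hGc.surjective hdiv hbot
  set e := hGm.orderIsoOfSurjective G hsurj with he
  have hec : Continuous e.symm := e.symm.continuous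
  have hGe : ∀ c, G (e.symm c) = c := fun c => e.apply_symm_apply c
  have hed : ∀ c, HasDerivAt e.symm (H (e.symm c)) c := fun c => by
    have := HasDerivAt.of_local_left_inverse (hec.continuousAt (x := c)) (hGd (e.symm c))
      (one_div_pos.2 (hH0 _)).ne' (Eventually.of_forall hGe)
    simpa using this
  have hPd : ∀ r, HasDerivAt (fun r => ∫ y in (0:ℝ)..r, q y) (q r) r := fun r =>
    intervalIntegral.integral_hasDerivAt_right (hq.intervalIntegrable _ _)
      (hq.stronglyMeasurableAtFilter _ _) hq.continuousAt
  have hWd : ∀ r, HasDerivAt (fun r => e.symm (∫ y in (0:ℝ)..r, q y))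
      (H (e.symm (∫ y in (0:ℝ)..r, q y)) * q r) r := fun r => (hed _).comp r (hPd r)
  have hWc : Continuous fun r => e.symm (∫ y in (0:ℝ)..r, q y) :=
    continuous_iff_continuousAt.2 fun r => (hWd r).continuousAt
  refine ⟨_, hWc, fun r => ?_⟩
  rw [intervalIntegral.integral_eq_sub_of_hasDerivAt (fun x _ => hWd x)
    (((hH.comp hWc).mul hq).intervalIntegrable _ _)]
  have : e.symm 0 = a := hGm.injective (by rw [hGe]; simp [hG])
  simp [this]

/-- The integrand of the radial integral operator attached to the kernels `Bm`, `Bp`. -/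
def radialIntegrand (Bm Bp : ℝ → ℝ) (α : ℝ) (g : ℝ → ℝ) (y : ℝ) : ℝ :=
  (Bm y * ∫ t in (0:ℝ)..y, Bp t * g t) ^ α

section Kernel

variable {Bm Bp R g g' : ℝ → ℝ} {α : ℝ}

theorem intervalIntegrable_mul_monotoneOn (hBp : ContinuousOn Bp (Ici 0))
    (hg : MonotoneOn g (Ici 0)) {y : ℝ} (hy : 0 ≤ y) :
    IntervalIntegrable (fun t => Bp t * g t) volume 0 y := by
  have hsub : uIcc 0 y ⊆ Ici (0:ℝ) := by rw [uIcc_of_le hy]; exact Icc_subset_Ici_self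
  exact (hg.mono hsub).intervalIntegrable.continuousOn_mul (hBp.mono hsub)

theorem integral_mul_nonneg (hBp0 : ∀ t ∈ Ici (0:ℝ), 0 ≤ Bp t)
    (hg0 : ∀ t ∈ Ici (0:ℝ), 0 ≤ g t) {y : ℝ} (hy : 0 ≤ y) :
    0 ≤ ∫ t in (0:ℝ)..y, Bp t * g t :=
  intervalIntegral.integral_nonneg hy fun t ht => mul_nonneg (hBp0 t ht.1) (hg0 t ht.1)

theorem radialIntegrand_nonneg (hBm0 : ∀ t ∈ Ici (0:ℝ), 0 ≤ Bm t)
    (hBp0 : ∀ t ∈ Ici (0:ℝ), 0 ≤ Bp t) (hg0 : ∀ t ∈ Ici (0:ℝ), 0 ≤ g t)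
    {y : ℝ} (hy : 0 ≤ y) : 0 ≤ radialIntegrand Bm Bp α g y :=
  rpow_nonneg (mul_nonneg (hBm0 y hy) (integral_mul_nonneg hBp0 hg0 hy)) _

theorem radialIntegrand_mono (hα : 0 ≤ α) (hBp : ContinuousOn Bp (Ici 0))
    (hBm0 : ∀ t ∈ Ici (0:ℝ), 0 ≤ Bm t)
    (hBp0 : ∀ t ∈ Ici (0:ℝ), 0 ≤ Bp t) (hg0 : ∀ t ∈ Ici (0:ℝ), 0 ≤ g t)
    (hg : MonotoneOn g (Ici 0)) (hg' : MonotoneOn g' (Ici 0))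
    (hle : ∀ t ∈ Ici (0:ℝ), g t ≤ g' t) {y : ℝ} (hy : 0 ≤ y) :
    radialIntegrand Bm Bp α g y ≤ radialIntegrand Bm Bp α g' y := by
  refine rpow_le_rpow (mul_nonneg (hBm0 y hy) (integral_mul_nonneg hBp0 hg0 hy)) ?_ hα
  refine mul_le_mul_of_nonneg_left ?_ (hBm0 y hy)
  exact intervalIntegral.integral_mono_on hy (intervalIntegrable_mul_monotoneOn hBp hg hy)
    (intervalIntegrable_mul_monotoneOn hBp hg' hy)
    fun t ht => mul_le_mul_of_nonneg_left (hle t ht.1) (hBp0 t ht.1)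

theorem radialIntegrand_le (hα : 0 ≤ α) (hBp : ContinuousOn Bp (Ici 0))
    (hBm0 : ∀ t ∈ Ici (0:ℝ), 0 ≤ Bm t)
    (hBp0 : ∀ t ∈ Ici (0:ℝ), 0 ≤ Bp t) (hR0 : ∀ y, 0 ≤ R y)
    (hR : ∀ t y, 0 ≤ t → t ≤ y → y * (Bm y * Bp t) ≤ R y)
    (hg0 : ∀ t ∈ Ici (0:ℝ), 0 ≤ g t) (hg : MonotoneOn g (Ici 0)) {y : ℝ} (hy : 0 ≤ y) :
    radialIntegrand Bm Bp α g y ≤ g y ^ α * R y ^ α := by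
  rw [← mul_rpow (hg0 y hy) (hR0 y)]
  refine rpow_le_rpow (mul_nonneg (hBm0 y hy) (integral_mul_nonneg hBp0 hg0 hy)) ?_ hα
  rcases hy.eq_or_lt with rfl | hy'
  · simpa using mul_nonneg (hg0 0 self_mem_Ici) (hR0 0)
  rw [← intervalIntegral.integral_const_mul]
  calc ∫ t in (0:ℝ)..y, Bm y * (Bp t * g t)
      ≤ ∫ t in (0:ℝ)..y, g y * R y / y := by
        refine intervalIntegral.integral_mono_on hy
          ((intervalIntegrable_mul_monotoneOn hBp hg hy).const_mul _)
          intervalIntegrable_const fun t ht => ?_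
        rw [le_div_iff₀ hy']
        have h1 := hR t y ht.1 ht.2
        have h2 : g t ≤ g y := hg ht.1 hy ht.2
        have h3 : 0 ≤ y * (Bm y * Bp t) :=
          mul_nonneg hy (mul_nonneg (hBm0 y hy) (hBp0 t ht.1))
        calc Bm y * (Bp t * g t) * y = g t * (y * (Bm y * Bp t)) := by ring
          _ ≤ g y * R y := mul_le_mul h2 h1 h3 (hg0 y hy)
    _ = g y * R y := by
        rw [intervalIntegral.integral_const, smul_eq_mul]; field_simp; simp

theorem intervalIntegrable_radialIntegrand (hα : 0 ≤ α) (hBp : ContinuousOn Bp (Ici 0))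
    (hBm : ContinuousOn Bm (Ioi 0)) (hBm0 : ∀ t ∈ Ici (0:ℝ), 0 ≤ Bm t)
    (hBp0 : ∀ t ∈ Ici (0:ℝ), 0 ≤ Bp t) (hRc : Continuous R) (hR0 : ∀ y, 0 ≤ R y)
    (hR : ∀ t y, 0 ≤ t → t ≤ y → y * (Bm y * Bp t) ≤ R y)
    (hg0 : ∀ t ∈ Ici (0:ℝ), 0 ≤ g t) (hg : MonotoneOn g (Ici 0)) {r : ℝ} (hr : 0 ≤ r) :
    IntervalIntegrable (radialIntegrand Bm Bp α g) volume 0 r := by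
  have hI := (intervalIntegrable_mul_monotoneOn hBp hg hr)
  have hbd : IntervalIntegrable (fun y => g r ^ α * R y ^ α) volume 0 r :=
    (continuous_const.mul (hRc.rpow_const fun _ => Or.inr hα)).intervalIntegrable _ _
  have hprim : ContinuousOn (fun y => ∫ t in (0:ℝ)..y, Bp t * g t) (Ioc 0 r) := by
    refine (intervalIntegral.continuousOn_primitive_interval' hI left_mem_uIcc).mono ?_
    rw [uIcc_of_le hr]; exact Ioc_subset_Icc_self
  have hcont : ContinuousOn (radialIntegrand Bm Bp α g) (Ioc 0 r) :=
    ((hBm.mono fun y hy => hy.1).mul hprim).rpow_const fun _ _ => Or.inr hα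
  refine hbd.mono_fun ?_ ?_
  · rw [uIoc_of_le hr]; exact hcont.aestronglyMeasurable measurableSet_Ioc
  · rw [uIoc_of_le hr]
    refine (ae_restrict_iff' measurableSet_Ioc).2 (Eventually.of_forall fun y hy => ?_)
    have hy0 : 0 ≤ y := hy.1.le
    simp only
    rw [norm_of_nonneg (radialIntegrand_nonneg hBm0 hBp0 hg0 hy0),
      norm_of_nonneg (mul_nonneg (rpow_nonneg (hg0 r hr) _) (rpow_nonneg (hR0 y) _))]
    refine (radialIntegrand_le hα hBp hBm0 hBp0 hR0 hR hg0 hg hy0).trans ?_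
    exact mul_le_mul_of_nonneg_right (rpow_le_rpow (hg0 y hy0) (hg hy0 hr hy.2) hα)
      (rpow_nonneg (hR0 y) _)

end Kernel

/-- Continuity, nonnegativity and the pointwise bound needed from the kernels. -/
theorem hessian_kernel_properties {N k : ℕ} (hk : 1 ≤ k) (hkN : k ≤ N) {b p : ℝ → ℝ}
    (hb : ContinuousOn b (Ici 0)) (hp : ContinuousOn p (Ici 0))
    (hb0 : ∀ t ∈ Ici (0:ℝ), 0 ≤ b t) (hp0 : ∀ t ∈ Ici (0:ℝ), 0 ≤ p t) {C : ℝ} (hC : 0 < C)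
    {Bm Bp : ℝ → ℝ}
    (hBm : ∀ ξ : ℝ, Bm ξ = ξ ^ ((k : ℤ) - (N : ℤ)) / C *
      Real.exp (-(∫ t in (0:ℝ)..ξ, (1 / C) * t ^ (k - 1) * b t)))
    (hBp : ∀ ξ : ℝ, Bp ξ = ξ ^ (N - 1) *
      Real.exp (∫ t in (0:ℝ)..ξ, (1 / C) * t ^ (k - 1) * b t) * p ξ) :
    ContinuousOn Bp (Ici 0) ∧ ContinuousOn Bm (Ioi 0) ∧ (∀ t ∈ Ici (0:ℝ), 0 ≤ Bm t) ∧
      (∀ t ∈ Ici (0:ℝ), 0 ≤ Bp t) ∧ ∃ R : ℝ → ℝ, Continuous R ∧ (∀ y, 0 ≤ R y) ∧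
        ∀ t y, 0 ≤ t → t ≤ y → y * (Bm y * Bp t) ≤ R y := by
  set E : ℝ → ℝ := fun ξ => ∫ t in (0:ℝ)..ξ, (1 / C) * t ^ (k - 1) * b t with hE
  have hmax : ∀ {h : ℝ → ℝ}, ContinuousOn h (Ici 0) → Continuous fun t => h (max t 0) :=
    fun hh => hh.comp_continuous (by fun_prop) fun t => le_max_right t 0
  have hint : ContinuousOn (fun t => (1 / C) * t ^ (k - 1) * b t) (Ici 0) := by fun_prop
  have hintg : ∀ x y, 0 ≤ x → 0 ≤ y →
      IntervalIntegrable (fun t => (1 / C) * t ^ (k - 1) * b t) volume x y := fun x y hx hy =>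
    (hint.mono fun t ht => (le_min hx hy).trans ht.1).intervalIntegrable
  have hEc : ContinuousOn E (Ici 0) := by
    have h1 : Continuous fun ξ => ∫ t in (0:ℝ)..ξ, (1 / C) * (max t 0) ^ (k - 1) * b (max t 0) :=
      intervalIntegral.continuous_primitive
        (fun x y => (hmax hint).intervalIntegrable x y) 0
    refine h1.continuousOn.congr fun ξ hξ => intervalIntegral.integral_congr fun t ht => ?_
    rw [uIcc_of_le hξ] at ht
    simp only [max_eq_left ht.1]
  have hEm : ∀ t y, 0 ≤ t → t ≤ y → E t ≤ E y := fun t y ht hty => by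
    have h2 := intervalIntegral.integral_add_adjacent_intervals (hintg 0 t le_rfl ht)
      (hintg t y ht (ht.trans hty))
    have h3 : 0 ≤ ∫ s in t..y, (1 / C) * s ^ (k - 1) * b s :=
      intervalIntegral.integral_nonneg hty fun s hs => by
        have hs0 : 0 ≤ s := ht.trans hs.1
        have := hb0 s hs0
        positivity
    simp only [hE]; linarith
  have hBmE : ∀ ξ, Bm ξ = ξ ^ ((k : ℤ) - (N : ℤ)) / C * Real.exp (-E ξ) := hBm
  have hBpE : ∀ ξ, Bp ξ = ξ ^ (N - 1) * Real.exp (E ξ) * p ξ := hBp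
  refine ⟨?_, ?_, ?_, ?_, ?_⟩
  · rw [show Bp = _ from funext hBpE]
    exact ((continuous_id.pow _).continuousOn.mul hEc.rexp).mul hp
  · rw [show Bm = _ from funext hBmE]
    refine ContinuousOn.mul (ContinuousOn.div_const ?_ _)
      (hEc.mono Ioi_subset_Ici_self).neg.rexp
    exact continuousOn_id.zpow₀ _ fun x hx => Or.inl (ne_of_gt hx)
  · intro t ht
    have ht' : (0:ℝ) ≤ t := ht
    rw [hBmE]; positivity
  · intro t ht
    have ht' : (0:ℝ) ≤ t := ht
    have := hp0 t ht
    rw [hBpE]; positivity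
  · have hpc := hmax hp
    have hcont : Continuous fun y => sSup ((fun s : ℝ => p (max (s * y) 0)) '' Icc 0 1) :=
      isCompact_Icc.continuous_sSup (f := fun y s => p (max (s * y) 0))
        (hpc.comp (by fun_prop : Continuous fun z : ℝ × ℝ => z.2 * z.1))
    have hle : ∀ y, ∀ s ∈ Icc (0:ℝ) 1,
        p (max (s * y) 0) ≤ sSup ((fun s : ℝ => p (max (s * y) 0)) '' Icc 0 1) := fun y s hs =>
      le_csSup (isCompact_Icc.bddAbove_image
        (hpc.comp (continuous_mul_const y)).continuousOn) ⟨s, hs, rfl⟩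
    set M : ℝ → ℝ := fun y => sSup ((fun s : ℝ => p (max (s * y) 0)) '' Icc 0 1) with hM
    have hM0 : ∀ y, 0 ≤ M y := fun y =>
      (hp0 (max (0 * y) 0) (le_max_right (0 * y) 0)).trans (hle y 0 (by simp))
    refine ⟨fun y => |y| ^ k * M y / C, by fun_prop, fun y => ?_, fun t y ht hty => ?_⟩
    · have := hM0 y
      positivity
    · have hy : 0 ≤ y := ht.trans hty
      rcases hy.eq_or_lt with rfl | hy'
      · have := hM0 0
        rw [zero_mul]; positivity
      have hpt : p t ≤ M y := by
        have := hle y (t / y) ⟨by positivity, (div_le_one hy').2 hty⟩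
        rwa [div_mul_cancel₀ _ hy'.ne', max_eq_left ht] at this
      have hpt0 := hp0 t ht
      have hpow : t ^ (N - 1) ≤ y ^ (N - 1) := pow_le_pow_left₀ ht hty _
      have hexp : Real.exp (-E y) * Real.exp (E t) ≤ 1 := by
        rw [← Real.exp_add, Real.exp_le_one_iff]
        linarith [hEm t y ht hty]
      have hyk : y * y ^ ((k : ℤ) - (N : ℤ)) * y ^ (N - 1) = y ^ k := by
        rw [← zpow_natCast y (N - 1), ← zpow_natCast y k, ← zpow_one_add₀ hy'.ne',
          ← zpow_add₀ hy'.ne']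
        congr 1
        omega
      simp only
      rw [hBmE, hBpE, abs_of_nonneg hy, ← hyk]
      calc y * (y ^ ((k : ℤ) - (N : ℤ)) / C * Real.exp (-E y) *
            (t ^ (N - 1) * Real.exp (E t) * p t))
          = y * y ^ ((k : ℤ) - (N : ℤ)) * t ^ (N - 1) * p t / C *
            (Real.exp (-E y) * Real.exp (E t)) := by ring
        _ ≤ y * y ^ ((k : ℤ) - (N : ℤ)) * t ^ (N - 1) * p t / C * 1 := by gcongr
        _ ≤ y * y ^ ((k : ℤ) - (N : ℤ)) * y ^ (N - 1) * M y / C := by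
            rw [mul_one]; gcongr

/-- Properties of a nonlinear integrand operator `I` that make the associated radial integral
operator order preserving, with `I g ≤ g ^ α * Q`. -/
structure IsAdmissibleIntegrand (I : (ℝ → ℝ) → ℝ → ℝ) (α : ℝ) (Q : ℝ → ℝ) : Prop where
  continuous_bound : Continuous Q
  bound_nonneg : ∀ y, 0 ≤ Q y
  nonneg : ∀ g, MonotoneOn g (Ici 0) → (∀ t ∈ Ici (0:ℝ), 0 ≤ g t) → ∀ y, 0 ≤ y → 0 ≤ I g y
  le : ∀ g, MonotoneOn g (Ici 0) → (∀ t ∈ Ici (0:ℝ), 0 ≤ g t) →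
    ∀ y, 0 ≤ y → I g y ≤ g y ^ α * Q y
  mono : ∀ g g', MonotoneOn g (Ici 0) → MonotoneOn g' (Ici 0) → (∀ t ∈ Ici (0:ℝ), 0 ≤ g t) →
    (∀ t ∈ Ici (0:ℝ), g t ≤ g' t) → ∀ y, 0 ≤ y → I g y ≤ I g' y
  integrable : ∀ g, MonotoneOn g (Ici 0) → (∀ t ∈ Ici (0:ℝ), 0 ≤ g t) →
    ∀ r, 0 ≤ r → IntervalIntegrable (I g) volume 0 r

theorem exists_isAdmissibleIntegrand {N k : ℕ} (hk : 1 ≤ k) (hkN : k ≤ N) {b p : ℝ → ℝ}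
    (hb : ContinuousOn b (Ici 0)) (hp : ContinuousOn p (Ici 0))
    (hb0 : ∀ t ∈ Ici (0:ℝ), 0 ≤ b t) (hp0 : ∀ t ∈ Ici (0:ℝ), 0 ≤ p t) {C : ℝ} (hC : 0 < C)
    {Bm Bp : ℝ → ℝ}
    (hBm : ∀ ξ : ℝ, Bm ξ = ξ ^ ((k : ℤ) - (N : ℤ)) / C *
      Real.exp (-(∫ t in (0:ℝ)..ξ, (1 / C) * t ^ (k - 1) * b t)))
    (hBp : ∀ ξ : ℝ, Bp ξ = ξ ^ (N - 1) *
      Real.exp (∫ t in (0:ℝ)..ξ, (1 / C) * t ^ (k - 1) * b t) * p ξ) {α : ℝ} (hα : 0 ≤ α) :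
    ∃ Q, IsAdmissibleIntegrand (radialIntegrand Bm Bp α) α Q := by
  obtain ⟨hBpc, hBmc, hBm0, hBp0, R, hRc, hR0, hR⟩ :=
    hessian_kernel_properties hk hkN hb hp hb0 hp0 hC hBm hBp
  exact ⟨fun y => R y ^ α,
    { continuous_bound := hRc.rpow_const fun _ => Or.inr hα
      bound_nonneg := fun y => rpow_nonneg (hR0 y) _
      nonneg := fun g _ hg0 y hy => radialIntegrand_nonneg hBm0 hBp0 hg0 hy
      le := fun g hg hg0 y hy => radialIntegrand_le hα hBpc hBm0 hBp0 hR0 hR hg0 hg hy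
      mono := fun g g' hg hg' hg0 hle y hy =>
        radialIntegrand_mono hα hBpc hBm0 hBp0 hg0 hg hg' hle hy
      integrable := fun g hg hg0 r hr =>
        intervalIntegrable_radialIntegrand hα hBpc hBmc hBm0 hBp0 hRc hR0 hR hg0 hg hr }⟩

namespace IsAdmissibleIntegrand

variable {I : (ℝ → ℝ) → ℝ → ℝ} {α : ℝ} {Q g g' : ℝ → ℝ}

theorem integral_mono_right (h : IsAdmissibleIntegrand I α Q) (hg : MonotoneOn g (Ici 0))
    (hg0 : ∀ t ∈ Ici (0:ℝ), 0 ≤ g t) {r s : ℝ} (hr : 0 ≤ r) (hrs : r ≤ s) :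
    ∫ y in (0:ℝ)..r, I g y ≤ ∫ y in (0:ℝ)..s, I g y := by
  refine intervalIntegral.integral_mono_interval le_rfl hr hrs ?_
    (h.integrable g hg hg0 s (hr.trans hrs))
  exact (ae_restrict_iff' measurableSet_Ioc).2
    (Eventually.of_forall fun y hy => h.nonneg g hg hg0 y hy.1.le)

theorem integral_nonneg (h : IsAdmissibleIntegrand I α Q) (hg : MonotoneOn g (Ici 0))
    (hg0 : ∀ t ∈ Ici (0:ℝ), 0 ≤ g t) {r : ℝ} (hr : 0 ≤ r) :
    0 ≤ ∫ y in (0:ℝ)..r, I g y :=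
  intervalIntegral.integral_nonneg hr fun y hy => h.nonneg g hg hg0 y hy.1

theorem integral_mono (h : IsAdmissibleIntegrand I α Q) (hg : MonotoneOn g (Ici 0))
    (hg' : MonotoneOn g' (Ici 0)) (hg0 : ∀ t ∈ Ici (0:ℝ), 0 ≤ g t)
    (hle : ∀ t ∈ Ici (0:ℝ), g t ≤ g' t) {r : ℝ} (hr : 0 ≤ r) :
    ∫ y in (0:ℝ)..r, I g y ≤ ∫ y in (0:ℝ)..r, I g' y :=
  intervalIntegral.integral_mono_on hr (h.integrable g hg hg0 r hr)
    (h.integrable g' hg' (fun t ht => (hg0 t ht).trans (hle t ht)) r hr)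
    fun y hy => h.mono g g' hg hg' hg0 hle y hy.1

theorem continuousOn_integral (h : IsAdmissibleIntegrand I α Q) (hg : MonotoneOn g (Ici 0))
    (hg0 : ∀ t ∈ Ici (0:ℝ), 0 ≤ g t) :
    ContinuousOn (fun r => ∫ y in (0:ℝ)..r, I g y) (Ici 0) := by
  intro x hx
  have hx0 : (0:ℝ) ≤ x := hx
  have h1 := intervalIntegral.continuousOn_primitive_interval'
    (h.integrable g hg hg0 (x + 1) (by linarith)) left_mem_uIcc
  rw [uIcc_of_le (by linarith)] at h1
  refine (h1 x ⟨hx0, by linarith⟩).mono_of_mem_nhdsWithin ?_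
  rw [← Ici_inter_Iic]
  exact inter_mem self_mem_nhdsWithin (mem_nhdsWithin_of_mem_nhds (Iic_mem_nhds (by linarith)))

theorem integral_le (h : IsAdmissibleIntegrand I α Q) (hg : MonotoneOn g (Ici 0))
    (hg0 : ∀ t ∈ Ici (0:ℝ), 0 ≤ g t) {G q : ℝ → ℝ} (hG : ∀ t ∈ Ici (0:ℝ), g t ^ α ≤ G t)
    (hQq : ∀ t, Q t ≤ q t) {r : ℝ} (hr : 0 ≤ r)
    (hint : IntervalIntegrable (fun y => G y * q y) volume 0 r) :
    ∫ y in (0:ℝ)..r, I g y ≤ ∫ y in (0:ℝ)..r, G y * q y :=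
  intervalIntegral.integral_mono_on hr (h.integrable g hg hg0 r hr) hint fun y hy =>
    (h.le g hg hg0 y hy.1).trans (mul_le_mul (hG y hy.1) (hQq y) (h.bound_nonneg y)
      ((rpow_nonneg (hg0 y hy.1) _).trans (hG y hy.1)))

end IsAdmissibleIntegrand

/-- Existence for the coupled integral system, as a Tarski fixed point below a supersolution. -/
theorem exists_monotone_solution {I₁ I₂ : (ℝ → ℝ) → ℝ → ℝ} {α₁ α₂ : ℝ} {Q₁ Q₂ : ℝ → ℝ}
    (h₁ : IsAdmissibleIntegrand I₁ α₁ Q₁) (h₂ : IsAdmissibleIntegrand I₂ α₂ Q₂)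
    (hα₁ : 0 ≤ α₁) (hα₂ : 0 ≤ α₂) {a₁ a₂ : ℝ} (ha₁ : 0 ≤ a₁) (ha₂ : 0 ≤ a₂)
    {f₁ f₂ : ℝ → ℝ → ℝ}
    (hf₁c : ContinuousOn (fun q : ℝ × ℝ => f₁ q.1 q.2) (Ici 0 ×ˢ Ici 0))
    (hf₂c : ContinuousOn (fun q : ℝ × ℝ => f₂ q.1 q.2) (Ici 0 ×ˢ Ici 0))
    (hf₁0 : ∀ x ∈ Ici (0:ℝ), ∀ y ∈ Ici (0:ℝ), 0 ≤ f₁ x y)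
    (hf₂0 : ∀ x ∈ Ici (0:ℝ), ∀ y ∈ Ici (0:ℝ), 0 ≤ f₂ x y)
    (hf₁mono : ∀ x x' y y' : ℝ, 0 ≤ x → x ≤ x' → 0 ≤ y → y ≤ y' → f₁ x y ≤ f₁ x' y')
    (hf₂mono : ∀ x x' y y' : ℝ, 0 ≤ x → x ≤ x' → 0 ≤ y → y ≤ y' → f₂ x y ≤ f₂ x' y')
    (hfpos : ∀ t : ℝ, a₁ + a₂ ≤ t → 0 < f₁ t t ^ α₁ + f₂ t t ^ α₂)
    (hdiv : Tendsto (fun r => ∫ t in (a₁ + a₂)..r, 1 / (f₁ t t ^ α₁ + f₂ t t ^ α₂))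
      atTop atTop) :
    ∃ u₁ u₂ : ℝ → ℝ, ContinuousOn u₁ (Ici 0) ∧ ContinuousOn u₂ (Ici 0) ∧
      (∀ r ∈ Ici (0:ℝ), u₁ r = a₁ + ∫ y in (0:ℝ)..r, I₁ (fun t => f₁ (u₁ t) (u₂ t)) y) ∧
      (∀ r ∈ Ici (0:ℝ), u₂ r = a₂ + ∫ y in (0:ℝ)..r, I₂ (fun t => f₂ (u₁ t) (u₂ t)) y) ∧
      MonotoneOn u₁ (Ici 0) ∧ MonotoneOn u₂ (Ici 0) := by
  set a := a₁ + a₂ with ha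
  have ha0 : 0 ≤ a := add_nonneg ha₁ ha₂
  have hmax0 : ∀ t, 0 ≤ max t a := fun t => ha0.trans (le_max_right t a)
  have hdiag : Continuous fun t : ℝ => (max t a, max t a) := by fun_prop
  set φ₁ : ℝ → ℝ := fun t => f₁ (max t a) (max t a) ^ α₁ with hφ₁
  set φ₂ : ℝ → ℝ := fun t => f₂ (max t a) (max t a) ^ α₂ with hφ₂
  have hφ₁c : Continuous φ₁ :=
    (hf₁c.comp_continuous hdiag fun t => ⟨hmax0 t, hmax0 t⟩).rpow_const fun _ => Or.inr hα₁
  have hφ₂c : Continuous φ₂ :=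
    (hf₂c.comp_continuous hdiag fun t => ⟨hmax0 t, hmax0 t⟩).rpow_const fun _ => Or.inr hα₂
  have hφ₁0 : ∀ t, 0 ≤ φ₁ t := fun t => rpow_nonneg (hf₁0 _ (hmax0 t) _ (hmax0 t)) _
  have hφ₂0 : ∀ t, 0 ≤ φ₂ t := fun t => rpow_nonneg (hf₂0 _ (hmax0 t) _ (hmax0 t)) _
  set q : ℝ → ℝ := fun y => Q₁ y + Q₂ y with hq
  have hqc : Continuous q := h₁.continuous_bound.add h₂.continuous_bound
  have hq0 : ∀ y, 0 ≤ q y := fun y => add_nonneg (h₁.bound_nonneg y) (h₂.bound_nonneg y)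
  have hQ₁q : ∀ y, Q₁ y ≤ q y := fun y => le_add_of_nonneg_right (h₂.bound_nonneg y)
  have hQ₂q : ∀ y, Q₂ y ≤ q y := fun y => le_add_of_nonneg_left (h₁.bound_nonneg y)
  obtain ⟨W, hWc, hW⟩ := exists_separable_solution (a := a) (H := fun t => φ₁ t + φ₂ t) (q := q)
    (hφ₁c.add hφ₂c) (fun t => hfpos _ (le_max_right t a))
    (fun t ht => by simp only [hφ₁, hφ₂, max_eq_right ht, max_self])
    (by
      refine hdiv.congr' ?_
      filter_upwards [eventually_ge_atTop a] with r hr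
      refine intervalIntegral.integral_congr fun t ht => ?_
      rw [uIcc_of_le hr] at ht
      simp only [hφ₁, hφ₂, max_eq_left ht.1]) hqc
  have hc₁ : Continuous fun y => φ₁ (W y) * q y := (hφ₁c.comp hWc).mul hqc
  have hc₂ : Continuous fun y => φ₂ (W y) * q y := (hφ₂c.comp hWc).mul hqc
  set W₁ : ℝ → ℝ := fun r => a₁ + ∫ y in (0:ℝ)..r, φ₁ (W y) * q y with hW₁
  set W₂ : ℝ → ℝ := fun r => a₂ + ∫ y in (0:ℝ)..r, φ₂ (W y) * q y with hW₂
  have haW₁ : ∀ r, 0 ≤ r → a₁ ≤ W₁ r := fun r hr => le_add_of_nonneg_right <|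
    intervalIntegral.integral_nonneg hr fun y _ => mul_nonneg (hφ₁0 _) (hq0 y)
  have haW₂ : ∀ r, 0 ≤ r → a₂ ≤ W₂ r := fun r hr => le_add_of_nonneg_right <|
    intervalIntegral.integral_nonneg hr fun y _ => mul_nonneg (hφ₂0 _) (hq0 y)
  have hWsum : ∀ r, W r = W₁ r + W₂ r := fun r => by
    rw [hW r]
    simp only [add_mul, hW₁, hW₂]
    rw [intervalIntegral.integral_add (hc₁.intervalIntegrable _ _) (hc₂.intervalIntegrable _ _)]
    ring
  set S : Set (ℝ → ℝ × ℝ) := {u | Monotone u ∧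
    ∀ r, (a₁, a₂) ≤ u r ∧ u r ≤ (W₁ (max r 0), W₂ (max r 0))} with hS
  set T : (ℝ → ℝ × ℝ) → ℝ → ℝ × ℝ := fun u r =>
    (a₁ + ∫ y in (0:ℝ)..(max r 0), I₁ (fun t => f₁ (u t).1 (u t).2) y,
      a₂ + ∫ y in (0:ℝ)..(max r 0), I₂ (fun t => f₂ (u t).1 (u t).2) y) with hT
  have hu0 : ∀ u ∈ S, ∀ r, 0 ≤ (u r).1 ∧ 0 ≤ (u r).2 := fun u hu r =>
    ⟨ha₁.trans (hu.2 r).1.1, ha₂.trans (hu.2 r).1.2⟩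
  have hg₁ : ∀ u ∈ S, MonotoneOn (fun t => f₁ (u t).1 (u t).2) (Ici 0) :=
    fun u hu r _ s _ hrs =>
      hf₁mono _ _ _ _ (hu0 u hu r).1 (hu.1 hrs).1 (hu0 u hu r).2 (hu.1 hrs).2
  have hg₂ : ∀ u ∈ S, MonotoneOn (fun t => f₂ (u t).1 (u t).2) (Ici 0) :=
    fun u hu r _ s _ hrs =>
      hf₂mono _ _ _ _ (hu0 u hu r).1 (hu.1 hrs).1 (hu0 u hu r).2 (hu.1 hrs).2
  have hg₁0 : ∀ u ∈ S, ∀ t ∈ Ici (0:ℝ), 0 ≤ f₁ (u t).1 (u t).2 := fun u hu t _ =>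
    hf₁0 _ (hu0 u hu t).1 _ (hu0 u hu t).2
  have hg₂0 : ∀ u ∈ S, ∀ t ∈ Ici (0:ℝ), 0 ≤ f₂ (u t).1 (u t).2 := fun u hu t _ =>
    hf₂0 _ (hu0 u hu t).1 _ (hu0 u hu t).2
  have huW : ∀ u ∈ S, ∀ t ∈ Ici (0:ℝ), (u t).1 ≤ max (W t) a ∧ (u t).2 ≤ max (W t) a := by
    intro u hu t ht
    have h := (hu.2 t).2
    rw [max_eq_left (show (0:ℝ) ≤ t from ht)] at h
    have e₁ : (u t).1 ≤ W₁ t := h.1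
    have e₂ : (u t).2 ≤ W₂ t := h.2
    have := haW₁ t ht
    have := haW₂ t ht
    have := hWsum t
    exact ⟨le_max_of_le_left (by linarith), le_max_of_le_left (by linarith)⟩
  have hG₁ : ∀ u ∈ S, ∀ t ∈ Ici (0:ℝ), f₁ (u t).1 (u t).2 ^ α₁ ≤ φ₁ (W t) := fun u hu t ht =>
    rpow_le_rpow (hg₁0 u hu t ht) (hf₁mono _ _ _ _ (hu0 u hu t).1 (huW u hu t ht).1
      (hu0 u hu t).2 (huW u hu t ht).2) hα₁
  have hG₂ : ∀ u ∈ S, ∀ t ∈ Ici (0:ℝ), f₂ (u t).1 (u t).2 ^ α₂ ≤ φ₂ (W t) := fun u hu t ht =>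
    rpow_le_rpow (hg₂0 u hu t ht) (hf₂mono _ _ _ _ (hu0 u hu t).1 (huW u hu t ht).1
      (hu0 u hu t).2 (huW u hu t ht).2) hα₂
  have hmr : ∀ r : ℝ, 0 ≤ max r 0 := fun r => le_max_right r 0
  have hTS : MapsTo T S S := by
    intro u hu
    refine ⟨fun r s hrs => ⟨?_, ?_⟩, fun r => ⟨⟨?_, ?_⟩, ⟨?_, ?_⟩⟩⟩
    · exact add_le_add_right (h₁.integral_mono_right (hg₁ u hu) (hg₁0 u hu) (hmr r)
        (max_le_max_right 0 hrs)) a₁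
    · exact add_le_add_right (h₂.integral_mono_right (hg₂ u hu) (hg₂0 u hu) (hmr r)
        (max_le_max_right 0 hrs)) a₂
    · exact le_add_of_nonneg_right (h₁.integral_nonneg (hg₁ u hu) (hg₁0 u hu) (hmr r))
    · exact le_add_of_nonneg_right (h₂.integral_nonneg (hg₂ u hu) (hg₂0 u hu) (hmr r))
    · exact add_le_add_right (h₁.integral_le (G := fun y => φ₁ (W y)) (hg₁ u hu) (hg₁0 u hu)
        (hG₁ u hu) hQ₁q (hmr r) (hc₁.intervalIntegrable _ _)) a₁
    · exact add_le_add_right (h₂.integral_le (G := fun y => φ₂ (W y)) (hg₂ u hu) (hg₂0 u hu)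
        (hG₂ u hu) hQ₂q (hmr r) (hc₂.intervalIntegrable _ _)) a₂
  have hTmono : MonotoneOn T S := by
    intro u hu v hv huv r
    refine ⟨?_, ?_⟩
    · exact add_le_add_right (h₁.integral_mono (hg₁ u hu) (hg₁ v hv) (hg₁0 u hu) (fun t _ =>
        hf₁mono _ _ _ _ (hu0 u hu t).1 (huv t).1 (hu0 u hu t).2 (huv t).2) (hmr r)) a₁
    · exact add_le_add_right (h₂.integral_mono (hg₂ u hu) (hg₂ v hv) (hg₂0 u hu) (fun t _ =>
        hf₂mono _ _ _ _ (hu0 u hu t).1 (huv t).1 (hu0 u hu t).2 (huv t).2) (hmr r)) a₂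
  have hSsup : ∀ A ⊆ S, A.Nonempty → ∃ x ∈ S, IsLUB A x := by
    rintro A hAS ⟨v₀, hv₀⟩
    have hex : ∀ r, ∃ z, IsLUB (Function.eval r '' A) z := fun r => by
      have hbdd : BddAbove (Function.eval r '' A) :=
        ⟨(W₁ (max r 0), W₂ (max r 0)), by rintro _ ⟨v, hv, rfl⟩; exact ((hAS hv).2 r).2⟩
      have hne : (Function.eval r '' A).Nonempty := ⟨_, v₀, hv₀, rfl⟩
      exact ⟨(_, _), isLUB_prod.2
        ⟨isLUB_csSup (hne.image _) (monotone_fst.map_bddAbove hbdd),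
          isLUB_csSup (hne.image _) (monotone_snd.map_bddAbove hbdd)⟩⟩
    choose x hxr using hex
    have hx : IsLUB A x := isLUB_pi.2 hxr
    refine ⟨x, ?_, hx⟩
    refine ⟨fun r s hrs => (hxr r).2 ?_, fun r => ⟨?_, (hxr r).2 ?_⟩⟩
    · rintro _ ⟨v, hv, rfl⟩
      exact ((hAS hv).1 hrs).trans (hx.1 hv s)
    · exact ((hAS hv₀).2 r).1.trans (hx.1 hv₀ r)
    · rintro _ ⟨v, hv, rfl⟩
      exact ((hAS hv).2 r).2
  have hbot : (fun _ => (a₁, a₂)) ∈ S :=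
    ⟨monotone_const, fun r => ⟨le_rfl, haW₁ _ (hmr r), haW₂ _ (hmr r)⟩⟩
  obtain ⟨u, hu, hfix⟩ := exists_fixedPoint_of_monotoneOn hTS hTmono hSsup hbot
    fun r => ((hTS hbot).2 r).1
  have e₁ : ∀ r ∈ Ici (0:ℝ), (u r).1 =
      a₁ + ∫ y in (0:ℝ)..r, I₁ (fun t => f₁ (u t).1 (u t).2) y := fun r hr => by
    have := congrArg Prod.fst (congrFun hfix r)
    simp only [hT, max_eq_left (show (0:ℝ) ≤ r from hr)] at this
    exact this.symm
  have e₂ : ∀ r ∈ Ici (0:ℝ), (u r).2 =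
      a₂ + ∫ y in (0:ℝ)..r, I₂ (fun t => f₂ (u t).1 (u t).2) y := fun r hr => by
    have := congrArg Prod.snd (congrFun hfix r)
    simp only [hT, max_eq_left (show (0:ℝ) ≤ r from hr)] at this
    exact this.symm
  exact ⟨fun r => (u r).1, fun r => (u r).2,
    (continuousOn_const.add (h₁.continuousOn_integral (hg₁ u hu) (hg₁0 u hu))).congr e₁,
    (continuousOn_const.add (h₂.continuousOn_integral (hg₂ u hu) (hg₂0 u hu))).congr e₂,
    e₁, e₂, fun r _ s _ hrs => (hu.1 hrs).1, fun r _ s _ hrs => (hu.1 hrs).2⟩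

/-- Theorem 1 (existence part): if `F(∞) = ∞` then the system has a radial solution with
central value `(a₁, a₂)`, and both components are nondecreasing on `[0, ∞)`. -/
theorem hessian_system_existence
    (N k₁ k₂ : ℕ) (hN : 3 ≤ N) (hk₁ : 1 ≤ k₁) (hk₁N : k₁ ≤ N) (hk₂ : 1 ≤ k₂) (hk₂N : k₂ ≤ N)
    (b₁ b₂ p₁ p₂ : ℝ → ℝ)
    (hb₁c : ContinuousOn b₁ (Set.Ici 0)) (hb₂c : ContinuousOn b₂ (Set.Ici 0))
    (hp₁c : ContinuousOn p₁ (Set.Ici 0)) (hp₂c : ContinuousOn p₂ (Set.Ici 0))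
    (hb₁0 : ∀ t ∈ Set.Ici (0:ℝ), 0 ≤ b₁ t) (hb₂0 : ∀ t ∈ Set.Ici (0:ℝ), 0 ≤ b₂ t)
    (hp₁0 : ∀ t ∈ Set.Ici (0:ℝ), 0 ≤ p₁ t) (hp₂0 : ∀ t ∈ Set.Ici (0:ℝ), 0 ≤ p₂ t)
    (C₀ C₀₀ : ℝ)
    (hC₀ : C₀ = (Nat.factorial (N-1) : ℝ) / ((Nat.factorial k₁ : ℝ) * (Nat.factorial (N - k₁) : ℝ)))
    (hC₀₀ : C₀₀ = (Nat.factorial (N-1) : ℝ) / ((Nat.factorial k₂ : ℝ) * (Nat.factorial (N - k₂) : ℝ)))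
    (B₁m B₁p B₂m B₂p : ℝ → ℝ)
    (hB₁m : ∀ ξ : ℝ, B₁m ξ = ξ ^ ((k₁ : ℤ) - (N : ℤ)) / C₀ *
      Real.exp (-(∫ t in (0:ℝ)..ξ, (1 / C₀) * t ^ (k₁ - 1) * b₁ t)))
    (hB₁p : ∀ ξ : ℝ, B₁p ξ = ξ ^ (N - 1) *
      Real.exp (∫ t in (0:ℝ)..ξ, (1 / C₀) * t ^ (k₁ - 1) * b₁ t) * p₁ ξ)
    (hB₂m : ∀ ξ : ℝ, B₂m ξ = ξ ^ ((k₂ : ℤ) - (N : ℤ)) / C₀₀ *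
      Real.exp (-(∫ t in (0:ℝ)..ξ, (1 / C₀₀) * t ^ (k₂ - 1) * b₂ t)))
    (hB₂p : ∀ ξ : ℝ, B₂p ξ = ξ ^ (N - 1) *
      Real.exp (∫ t in (0:ℝ)..ξ, (1 / C₀₀) * t ^ (k₂ - 1) * b₂ t) * p₂ ξ)
    (a₁ a₂ : ℝ) (ha₁ : 0 ≤ a₁) (ha₂ : 0 ≤ a₂) (ha : 0 < a₁ + a₂)
    (f₁ f₂ : ℝ → ℝ → ℝ)
    (hf₁c : ContinuousOn (fun q : ℝ × ℝ => f₁ q.1 q.2) (Set.Ici 0 ×ˢ Set.Ici 0))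
    (hf₂c : ContinuousOn (fun q : ℝ × ℝ => f₂ q.1 q.2) (Set.Ici 0 ×ˢ Set.Ici 0))
    (hf₁0 : ∀ x ∈ Set.Ici (0:ℝ), ∀ y ∈ Set.Ici (0:ℝ), 0 ≤ f₁ x y)
    (hf₂0 : ∀ x ∈ Set.Ici (0:ℝ), ∀ y ∈ Set.Ici (0:ℝ), 0 ≤ f₂ x y)
    (hf₁mono : ∀ x xQ y yQ : ℝ, 0 ≤ x → x ≤ xQ → 0 ≤ y → y ≤ yQ → f₁ x y ≤ f₁ xQ yQ)
    (hf₂mono : ∀ x xQ y yQ : ℝ, 0 ≤ x → x ≤ xQ → 0 ≤ y → y ≤ yQ → f₂ x y ≤ f₂ xQ yQ)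
    (F : ℝ → ℝ)
    (hF : ∀ r : ℝ, F r = ∫ t in (a₁+a₂)..r, 1 / (f₁ t t ^ (1/(k₁:ℝ)) + f₂ t t ^ (1/(k₂:ℝ))))
    (hfpos : ∀ t : ℝ, a₁ + a₂ ≤ t → 0 < f₁ t t ^ (1/(k₁:ℝ)) + f₂ t t ^ (1/(k₂:ℝ)))
    (hFinfty : Tendsto F atTop atTop) :
    ∃ u₁ u₂ : ℝ → ℝ,
      IsRadialSolution k₁ k₂ a₁ a₂ B₁m B₁p B₂m B₂p f₁ f₂ u₁ u₂ ∧
      MonotoneOn u₁ (Set.Ici 0) ∧ MonotoneOn u₂ (Set.Ici 0) := by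
  have hC₀pos : 0 < C₀ := by rw [hC₀]; positivity
  have hC₀₀pos : 0 < C₀₀ := by rw [hC₀₀]; positivity
  have hα₁ : (0:ℝ) ≤ 1 / (k₁:ℝ) := by positivity
  have hα₂ : (0:ℝ) ≤ 1 / (k₂:ℝ) := by positivity
  obtain ⟨Q₁, h₁⟩ :=
    exists_isAdmissibleIntegrand hk₁ hk₁N hb₁c hp₁c hb₁0 hp₁0 hC₀pos hB₁m hB₁p hα₁
  obtain ⟨Q₂, h₂⟩ :=
    exists_isAdmissibleIntegrand hk₂ hk₂N hb₂c hp₂c hb₂0 hp₂0 hC₀₀pos hB₂m hB₂p hα₂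
  obtain ⟨u₁, u₂, hc₁, hc₂, he₁, he₂, hm₁, hm₂⟩ := exists_monotone_solution h₁ h₂ hα₁ hα₂ ha₁ ha₂
    hf₁c hf₂c hf₁0 hf₂0 hf₁mono hf₂mono hfpos (hFinfty.congr hF)
  exact ⟨u₁, u₂, ⟨hc₁, hc₂, he₁, he₂⟩, hm₁, hm₂⟩
end
end

section
/- Assume F(∞) := lim_{r→∞} F(r) = ∞ and P₁(∞) + P₂(∞) < ∞, where P_i(∞) = lim_{r→∞} P_i(r). Then there exists a radial solution (u₁,u₂) with central value (a₁,a₂) such that lim_{r→∞} u₁(r) < ∞ and lim_{r→∞} u₂(r) < ∞; in fact u₁(r) + u₂(r) ≤ F⁻¹(P₁(∞) + P₂(∞)) for all r ≥ 0. -/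
open Real Filter MeasureTheory Set

noncomputable section

/-- The primitive based at `0` of a function integrable on every `[0, x]` is continuous
on `[0, ∞)`. -/
theorem continuousOn_primitive_Ici {φ : ℝ → ℝ}
    (hφ : ∀ x ∈ Ici (0:ℝ), IntervalIntegrable φ volume 0 x) :
    ContinuousOn (fun x => ∫ t in (0:ℝ)..x, φ t) (Ici 0) := by
  intro x hx
  have hx0 : (0:ℝ) ≤ x := hx
  have hx1 : (0:ℝ) ≤ x + 1 := by linarith
  have h := intervalIntegral.continuousOn_primitive_interval' (hφ (x + 1) hx1) left_mem_uIcc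
  rw [uIcc_of_le hx1] at h
  refine (h x ⟨hx0, by linarith⟩).mono_of_mem_nhdsWithin ?_
  rw [mem_nhdsWithin]
  exact ⟨Iio (x + 1), isOpen_Iio, by simp, fun y hy => ⟨hy.2, le_of_lt hy.1⟩⟩

theorem ContinuousOn.intervalIntegrable_Ici {φ : ℝ → ℝ} (hφ : ContinuousOn φ (Ici 0)) :
    ∀ x ∈ Ici (0:ℝ), IntervalIntegrable φ volume 0 x := fun x hx =>
  (hφ.mono (by rw [uIcc_of_le hx]; exact Icc_subset_Ici_self)).intervalIntegrable

/-- The primitive based at `0` of a nonnegative function is nondecreasing on `[0, ∞)`. -/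
theorem monotoneOn_primitive_Ici {φ : ℝ → ℝ} (hφ : ∀ x ∈ Ici (0:ℝ), IntervalIntegrable φ volume 0 x)
    (h0 : ∀ x ∈ Ici (0:ℝ), 0 ≤ φ x) :
    MonotoneOn (fun x => ∫ t in (0:ℝ)..x, φ t) (Ici 0) := by
  intro x hx y hy hxy
  refine intervalIntegral.integral_mono_interval le_rfl hx hxy ?_ (hφ y hy)
  filter_upwards [ae_restrict_mem measurableSet_Ioc] with t ht using h0 t ht.1.le

/-- A scalar separable equation `W' = g(W) q`, `W(0) = a`, has a global solution as soon as
`∫ 1/g` diverges at infinity. -/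
theorem exists_separable_solution_s1 {a : ℝ} {g q F : ℝ → ℝ}
    (hg : ContinuousOn g (Ici a)) (hg0 : ∀ t, a ≤ t → 0 < g t)
    (hq : ContinuousOn q (Ici 0))
    (hq0 : ∀ t ∈ Ici (0:ℝ), 0 ≤ q t)
    (hF : ∀ r, F r = ∫ t in a..r, 1 / g t) (hFtop : Tendsto F atTop atTop) :
    ∃ W : ℝ → ℝ, ContinuousOn W (Ici 0) ∧ (∀ r ∈ Ici (0:ℝ), a ≤ W r) ∧
      (∀ r ∈ Ici (0:ℝ), W r = a + ∫ t in (0:ℝ)..r, g (W t) * q t) ∧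
      ∀ r ∈ Ici (0:ℝ), ∀ L : ℝ, ∫ t in (0:ℝ)..r, q t ≤ L → ∃ s, a ≤ s ∧ F s = L ∧ W r ≤ s := by
  set G : ℝ → ℝ := fun t => g (max t a) with hG
  have hGc : Continuous G :=
    hg.comp_continuous (by fun_prop) (fun t => le_max_right t a)
  have hGpos : ∀ t, 0 < G t := fun t => hg0 _ (le_max_right t a)
  have hGic : Continuous (fun t => 1 / G t) := continuous_const.div hGc fun t => (hGpos t).ne'
  set Q : ℝ → ℝ := fun t => q (max t 0) with hQ
  have hQc : Continuous Q := hq.comp_continuous (by fun_prop) (fun t => le_max_right t 0)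
  have hQeq : ∀ t, 0 ≤ t → Q t = q t := fun t ht => by simp [hQ, ht]
  have hGeq : ∀ t, a ≤ t → G t = g t := fun t ht => by simp [hG, ht]
  set E : ℝ → ℝ := fun r => ∫ t in a..r, 1 / G t with hE
  have hEd : ∀ r, HasDerivAt E (1 / G r) r := fun r => hGic.integral_hasStrictDerivAt a r |>.hasDerivAt
  have hEc : Continuous E := continuous_iff_continuousAt.2 fun r => (hEd r).continuousAt
  have hEmono : StrictMono E := strictMono_of_deriv_pos fun r => by
    rw [(hEd r).deriv]; exact one_div_pos.2 (hGpos r)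
  have hEF : ∀ r, a ≤ r → E r = F r := fun r hr => by
    rw [hF, hE]
    refine intervalIntegral.integral_congr fun t ht => ?_
    rw [uIcc_of_le hr] at ht
    simp only [hGeq t ht.1]
  have hEtop : Tendsto E atTop atTop :=
    hFtop.congr' <| (eventually_ge_atTop a).mono fun r hr => (hEF r hr).symm
  have hEbot : Tendsto E atBot atBot := by
    have hlin : ∀ r ≤ a, E r = (r - a) * (1 / g a) := fun r hr => by
      have : E r = ∫ _ in a..r, 1 / g a := by
        refine intervalIntegral.integral_congr fun t ht => ?_
        rw [uIcc_of_ge hr] at ht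
        simp only [hG, max_eq_right ht.2]
      rw [this, intervalIntegral.integral_const, smul_eq_mul]
    have h1 : Tendsto (fun r : ℝ => (r - a) * (1 / g a)) atBot atBot :=
      (tendsto_atBot_add_const_right atBot (-a) tendsto_id).atBot_mul_const
        (one_div_pos.2 (hg0 a le_rfl))
    exact h1.congr' <| (eventually_le_atBot a).mono fun r hr => (hlin r hr).symm
  let e : ℝ ≃o ℝ := hEmono.orderIsoOfSurjective E (hEc.surjective hEtop hEbot)
  have he : ∀ x, e x = E x := fun x => rfl
  have hea : e a = 0 := by simp [he, hE]
  set I : ℝ → ℝ := fun r => ∫ t in (0:ℝ)..r, Q t with hI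
  have hId : ∀ r, HasDerivAt I (Q r) r := fun r => hQc.integral_hasStrictDerivAt 0 r |>.hasDerivAt
  have hI0 : ∀ r, 0 ≤ r → 0 ≤ I r := fun r hr =>
    intervalIntegral.integral_nonneg hr fun t _ => hq0 _ (le_max_right t 0)
  have hsymm : ∀ y, HasDerivAt e.symm (G (e.symm y)) y := fun y => by
    have := HasDerivAt.of_local_left_inverse (f := E) (g := e.symm) (a := y)
      e.symm.continuous.continuousAt (hEd _) (one_div_pos.2 (hGpos _)).ne'
      (Eventually.of_forall fun z => e.apply_symm_apply z)
    simpa using this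
  have hWd : ∀ r, HasDerivAt (fun r => e.symm (I r)) (G (e.symm (I r)) * Q r) r := fun r =>
    (hsymm (I r)).comp r (hId r)
  have hWc : Continuous fun r => e.symm (I r) :=
    continuous_iff_continuousAt.2 fun r => (hWd r).continuousAt
  have hWa : ∀ r, 0 ≤ r → a ≤ e.symm (I r) := fun r hr => by
    rw [e.le_symm_apply, hea]; exact hI0 r hr
  refine ⟨fun r => e.symm (I r), hWc.continuousOn, hWa, fun r hr => ?_, fun r hr L hL => ?_⟩
  · have h1 := intervalIntegral.integral_eq_sub_of_hasDerivAt (a := 0) (b := r)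
      (fun x _ => hWd x) (((hGc.comp hWc).mul hQc).intervalIntegrable 0 r)
    have h2 : e.symm (I 0) = a := by
      rw [e.symm_apply_eq, hea]; simp [hI]
    have h3 : ∫ t in (0:ℝ)..r, g (e.symm (I t)) * q t
        = ∫ t in (0:ℝ)..r, G (e.symm (I t)) * Q t := by
      refine intervalIntegral.integral_congr fun t ht => ?_
      rw [uIcc_of_le hr] at ht
      simp only [hGeq _ (hWa t ht.1), hQeq t ht.1]
    simp only
    rw [h3, h1, h2]; ring
  · have hIq : I r = ∫ t in (0:ℝ)..r, q t := by
      refine intervalIntegral.integral_congr fun t ht => ?_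
      rw [uIcc_of_le hr] at ht
      exact hQeq t ht.1
    have hle : e.symm (I r) ≤ e.symm L := e.symm.monotone (hIq.trans_le hL)
    refine ⟨e.symm L, (hWa r hr).trans hle, ?_, hle⟩
    rw [← hEF _ ((hWa r hr).trans hle)]
    exact e.apply_symm_apply L

/-- A pair of functions that are nondecreasing and bounded below by `(a₁, a₂)` on `[0, ∞)`. -/
structure IsMonotonePair (a₁ a₂ : ℝ) (v₁ v₂ : ℝ → ℝ) : Prop where
  mono₁ : MonotoneOn v₁ (Ici 0)
  mono₂ : MonotoneOn v₂ (Ici 0)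
  le₁ : ∀ r ∈ Ici (0:ℝ), a₁ ≤ v₁ r
  le₂ : ∀ r ∈ Ici (0:ℝ), a₂ ≤ v₂ r

/-- Knaster–Tarski for pairs of nondecreasing functions: an order-preserving operator with a
supersolution has a fixed point below it. -/
theorem IsMonotonePair.exists_fixedPoint {a₁ a₂ : ℝ} {T₁ T₂ : (ℝ → ℝ) → (ℝ → ℝ) → ℝ → ℝ}
    (hT : ∀ v₁ v₂, IsMonotonePair a₁ a₂ v₁ v₂ → IsMonotonePair a₁ a₂ (T₁ v₁ v₂) (T₂ v₁ v₂))
    (hmono : ∀ v₁ v₂ w₁ w₂, IsMonotonePair a₁ a₂ v₁ v₂ → IsMonotonePair a₁ a₂ w₁ w₂ →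
      (∀ r ∈ Ici (0:ℝ), v₁ r ≤ w₁ r ∧ v₂ r ≤ w₂ r) →
      ∀ r ∈ Ici (0:ℝ), T₁ v₁ v₂ r ≤ T₁ w₁ w₂ r ∧ T₂ v₁ v₂ r ≤ T₂ w₁ w₂ r)
    {W₁ W₂ : ℝ → ℝ} (hW : IsMonotonePair a₁ a₂ W₁ W₂)
    (hTW : ∀ r ∈ Ici (0:ℝ), T₁ W₁ W₂ r ≤ W₁ r ∧ T₂ W₁ W₂ r ≤ W₂ r) :
    ∃ u₁ u₂, IsMonotonePair a₁ a₂ u₁ u₂ ∧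
      (∀ r ∈ Ici (0:ℝ), u₁ r ≤ W₁ r ∧ u₂ r ≤ W₂ r) ∧
      ∀ r ∈ Ici (0:ℝ), u₁ r = T₁ u₁ u₂ r ∧ u₂ r = T₂ u₁ u₂ r := by
  let S : Set ((ℝ → ℝ) × (ℝ → ℝ)) := {v | IsMonotonePair a₁ a₂ v.1 v.2 ∧
    ∀ r ∈ Ici (0:ℝ), T₁ v.1 v.2 r ≤ v.1 r ∧ T₂ v.1 v.2 r ≤ v.2 r}
  have hWS : (W₁, W₂) ∈ S := ⟨hW, hTW⟩
  have : Nonempty S := ⟨⟨_, hWS⟩⟩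
  have hb₁ : ∀ r ∈ Ici (0:ℝ), BddBelow (range fun v : S => v.1.1 r) := fun r hr =>
    ⟨a₁, by rintro _ ⟨v, rfl⟩; exact v.2.1.le₁ r hr⟩
  have hb₂ : ∀ r ∈ Ici (0:ℝ), BddBelow (range fun v : S => v.1.2 r) := fun r hr =>
    ⟨a₂, by rintro _ ⟨v, rfl⟩; exact v.2.1.le₂ r hr⟩
  let u₁ : ℝ → ℝ := fun r => ⨅ v : S, v.1.1 r
  let u₂ : ℝ → ℝ := fun r => ⨅ v : S, v.1.2 r
  have hle : ∀ v ∈ S, ∀ r ∈ Ici (0:ℝ), u₁ r ≤ v.1 r ∧ u₂ r ≤ v.2 r := fun v hv r hr =>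
    ⟨ciInf_le (hb₁ r hr) (⟨v, hv⟩ : S), ciInf_le (hb₂ r hr) (⟨v, hv⟩ : S)⟩
  have hu : IsMonotonePair a₁ a₂ u₁ u₂ :=
    ⟨fun r hr s hs hrs => ciInf_mono (hb₁ r hr) fun v => v.2.1.mono₁ hr hs hrs,
      fun r hr s hs hrs => ciInf_mono (hb₂ r hr) fun v => v.2.1.mono₂ hr hs hrs,
      fun r hr => le_ciInf fun v => v.2.1.le₁ r hr,
      fun r hr => le_ciInf fun v => v.2.1.le₂ r hr⟩
  have hTu : ∀ r ∈ Ici (0:ℝ), T₁ u₁ u₂ r ≤ u₁ r ∧ T₂ u₁ u₂ r ≤ u₂ r := fun r hr =>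
    ⟨le_ciInf fun v => (hmono _ _ _ _ hu v.2.1 (hle v v.2) r hr).1.trans (v.2.2 r hr).1,
      le_ciInf fun v => (hmono _ _ _ _ hu v.2.1 (hle v v.2) r hr).2.trans (v.2.2 r hr).2⟩
  have hTuS : (T₁ u₁ u₂, T₂ u₁ u₂) ∈ S := ⟨hT _ _ hu, hmono _ _ _ _ (hT _ _ hu) hu hTu⟩
  exact ⟨u₁, u₂, hu, hle _ hWS, fun r hr =>
    ⟨(hle _ hTuS r hr).1.antisymm (hTu r hr).1, (hle _ hTuS r hr).2.antisymm (hTu r hr).2⟩⟩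

/-- The properties of the coefficients `B⁻`, `B⁺` on which the integral equation depends. -/
structure IsHessianWeight (m p : ℝ → ℝ) : Prop where
  nonneg_left : ∀ t ∈ Ici (0:ℝ), 0 ≤ m t
  nonneg_right : ∀ t ∈ Ici (0:ℝ), 0 ≤ p t
  continuousOn_left : ContinuousOn m (Ioi 0)
  continuousOn_right : ContinuousOn p (Ici 0)
  continuousOn_mul_integral : ContinuousOn (fun t => m t * ∫ s in (0:ℝ)..t, p s) (Ici 0)

/-- The coefficients `B⁻`, `B⁺` of the radial Hessian operator with convection are admissible:
near `0`, `B⁻(t) ∫₀ᵗ B⁺ ≤ C⁻¹ tᵏ⁻¹ ∫₀ᵗ p`. -/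
theorem isHessianWeight_of_formula {N k : ℕ} (hk : 1 ≤ k) {b p B P : ℝ → ℝ} {C : ℝ} (hC : 0 < C)
    (hN : 1 ≤ N)
    (hb : ContinuousOn b (Ici 0)) (hp : ContinuousOn p (Ici 0))
    (hb0 : ∀ t ∈ Ici (0:ℝ), 0 ≤ b t) (hp0 : ∀ t ∈ Ici (0:ℝ), 0 ≤ p t)
    (hB : ∀ ξ : ℝ, B ξ = ξ ^ ((k : ℤ) - (N : ℤ)) / C *
      Real.exp (-(∫ t in (0:ℝ)..ξ, (1 / C) * t ^ (k - 1) * b t)))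
    (hP : ∀ ξ : ℝ, P ξ = ξ ^ (N - 1) *
      Real.exp (∫ t in (0:ℝ)..ξ, (1 / C) * t ^ (k - 1) * b t) * p ξ) :
    IsHessianWeight B P := by
  set I : ℝ → ℝ := fun ξ => ∫ t in (0:ℝ)..ξ, (1 / C) * t ^ (k - 1) * b t with hI
  have hφ : ContinuousOn (fun t => (1 / C) * t ^ (k - 1) * b t) (Ici 0) := by fun_prop
  have hφ0 : ∀ t ∈ Ici (0:ℝ), 0 ≤ (1 / C) * t ^ (k - 1) * b t := fun t ht =>
    mul_nonneg (mul_nonneg (by positivity) (pow_nonneg ht _)) (hb0 t ht)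
  have hIc : ContinuousOn I (Ici 0) := continuousOn_primitive_Ici hφ.intervalIntegrable_Ici
  have hIm : MonotoneOn I (Ici 0) := monotoneOn_primitive_Ici hφ.intervalIntegrable_Ici hφ0
  have hBf : B = fun ξ => ξ ^ ((k : ℤ) - (N : ℤ)) / C * Real.exp (-I ξ) := funext hB
  have hPf : P = fun ξ => ξ ^ (N - 1) * Real.exp (I ξ) * p ξ := funext hP
  have hBc : ContinuousOn B (Ioi 0) := by
    have hI' : ContinuousOn I (Ioi 0) := hIc.mono Ioi_subset_Ici_self
    have hz : ContinuousOn (fun ξ : ℝ => ξ ^ ((k : ℤ) - (N : ℤ))) (Ioi 0) := fun ξ hξ =>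
      (continuousAt_zpow₀ ξ _ (Or.inl (ne_of_gt hξ))).continuousWithinAt
    rw [hBf]
    exact (hz.div_const C).mul (Real.continuous_exp.comp_continuousOn hI'.neg)
  have hPc : ContinuousOn P (Ici 0) := by
    rw [hPf]
    exact ((continuous_pow _).continuousOn.mul (Real.continuous_exp.comp_continuousOn hIc)).mul hp
  have hB0 : ∀ t ∈ Ici (0:ℝ), 0 ≤ B t := fun t ht => by
    have : (0:ℝ) ≤ t := ht
    rw [hBf]; positivity
  have hP0 : ∀ t ∈ Ici (0:ℝ), 0 ≤ P t := fun t ht => by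
    have h1 : (0:ℝ) ≤ t := ht
    have h2 := hp0 t ht
    rw [hPf]; positivity
  have hPi : ContinuousOn (fun t => ∫ s in (0:ℝ)..t, P s) (Ici 0) :=
    continuousOn_primitive_Ici hPc.intervalIntegrable_Ici
  have hpi : ContinuousOn (fun t => ∫ s in (0:ℝ)..t, p s) (Ici 0) :=
    continuousOn_primitive_Ici hp.intervalIntegrable_Ici
  refine ⟨hB0, hP0, hBc, hPc, fun t ht => ?_⟩
  rcases (show (0:ℝ) ≤ t from ht).eq_or_lt with rfl | htpos
  · have hbound : ∀ t ∈ Ici (0:ℝ), B t * ∫ s in (0:ℝ)..t, P s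
        ≤ t ^ (k - 1) / C * ∫ s in (0:ℝ)..t, p s := fun t ht => by
      rcases (show (0:ℝ) ≤ t from ht).eq_or_lt with rfl | htpos
      · simp
      have h1 : ∫ s in (0:ℝ)..t, P s ≤ ∫ s in (0:ℝ)..t, t ^ (N - 1) * Real.exp (I t) * p s := by
        refine intervalIntegral.integral_mono_on ht (hPc.intervalIntegrable_Ici t ht)
          ((hp.intervalIntegrable_Ici t ht).const_mul _) fun s hs => ?_
        rw [hPf]
        have hs0 : (0:ℝ) ≤ s := hs.1
        have := hp0 s hs.1
        have := hIm hs.1 ht hs.2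
        have := hs.2
        simp only
        gcongr
      rw [intervalIntegral.integral_const_mul] at h1
      refine (mul_le_mul_of_nonneg_left h1 (hB0 t ht)).trans_eq ?_
      have h2 : t ^ ((k : ℤ) - (N : ℤ)) * t ^ (N - 1) = t ^ (k - 1) := by
        rw [← zpow_natCast t (N - 1), ← zpow_natCast t (k - 1), ← zpow_add₀ htpos.ne']
        congr 1
        omega
      have h3 : Real.exp (-I t) * Real.exp (I t) = 1 := by rw [← Real.exp_add]; simp
      rw [hB]
      calc _ = (t ^ ((k : ℤ) - (N : ℤ)) * t ^ (N - 1)) / C * (Real.exp (-I t) * Real.exp (I t))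
            * ∫ s in (0:ℝ)..t, p s := by ring
        _ = _ := by rw [h2, h3, mul_one]
    have hlim : ContinuousWithinAt (fun t => t ^ (k - 1) / C * ∫ s in (0:ℝ)..t, p s) (Ici 0) 0 :=
      (((continuous_pow (k - 1)).div_const C).continuousOn.mul hpi) 0 (mem_Ici.2 le_rfl)
    rw [ContinuousWithinAt] at hlim ⊢
    simp only [intervalIntegral.integral_same, mul_zero] at hlim ⊢
    refine squeeze_zero' ?_ ?_ hlim
    · filter_upwards [self_mem_nhdsWithin] with t ht
      exact mul_nonneg (hB0 t ht) (intervalIntegral.integral_nonneg ht fun s hs => hP0 s hs.1)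
    · filter_upwards [self_mem_nhdsWithin] with t ht using hbound t ht
  · exact (hBc.continuousAt (Ioi_mem_nhds htpos)).continuousWithinAt.mul (hPi t ht)

namespace IsHessianWeight

variable {m p h h' : ℝ → ℝ} {α : ℝ}

theorem intervalIntegrable_mul (H : IsHessianWeight m p) (hm : MonotoneOn h (Ici 0)) :
    ∀ y ∈ Ici (0:ℝ), IntervalIntegrable (fun t => p t * h t) volume 0 y := fun y hy => by
  have hsub : uIcc 0 y ⊆ Ici 0 := by rw [uIcc_of_le hy]; exact Icc_subset_Ici_self
  exact (hm.mono hsub).intervalIntegrable.continuousOn_mul (H.continuousOn_right.mono hsub)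

theorem base_nonneg (H : IsHessianWeight m p) (h0 : ∀ t ∈ Ici (0:ℝ), 0 ≤ h t) :
    ∀ y ∈ Ici (0:ℝ), 0 ≤ m y * ∫ t in (0:ℝ)..y, p t * h t := fun y hy =>
  mul_nonneg (H.nonneg_left y hy) <| intervalIntegral.integral_nonneg hy fun t ht =>
    mul_nonneg (H.nonneg_right t ht.1) (h0 t ht.1)

theorem profile_nonneg (H : IsHessianWeight m p) :
    ∀ y ∈ Ici (0:ℝ), 0 ≤ (m y * ∫ t in (0:ℝ)..y, p t) ^ α := fun y hy =>
  Real.rpow_nonneg (mul_nonneg (H.nonneg_left y hy) <|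
    intervalIntegral.integral_nonneg hy fun t ht => H.nonneg_right t ht.1) _

theorem continuousOn_profile (H : IsHessianWeight m p) (hα : 0 ≤ α) :
    ContinuousOn (fun y => (m y * ∫ t in (0:ℝ)..y, p t) ^ α) (Ici 0) :=
  H.continuousOn_mul_integral.rpow_const fun _ _ => Or.inr hα

theorem integrand_le (H : IsHessianWeight m p) (hα : 0 ≤ α) (hm : MonotoneOn h (Ici 0))
    (h0 : ∀ t ∈ Ici (0:ℝ), 0 ≤ h t) :
    ∀ y ∈ Ici (0:ℝ), (m y * ∫ t in (0:ℝ)..y, p t * h t) ^ α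
      ≤ h y ^ α * (m y * ∫ t in (0:ℝ)..y, p t) ^ α := fun y hy => by
  have h1 : ∫ t in (0:ℝ)..y, p t * h t ≤ ∫ t in (0:ℝ)..y, p t * h y :=
    intervalIntegral.integral_mono_on hy (H.intervalIntegrable_mul hm y hy)
      ((H.continuousOn_right.intervalIntegrable_Ici y hy).mul_const _) fun t ht =>
        mul_le_mul_of_nonneg_left (hm ht.1 hy ht.2) (H.nonneg_right t ht.1)
  rw [intervalIntegral.integral_mul_const] at h1
  rw [← Real.mul_rpow (h0 y hy) (mul_nonneg (H.nonneg_left y hy) <|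
    intervalIntegral.integral_nonneg hy fun t ht => H.nonneg_right t ht.1)]
  refine Real.rpow_le_rpow (H.base_nonneg h0 y hy) ?_ hα
  calc _ ≤ m y * ((∫ t in (0:ℝ)..y, p t) * h y) :=
        mul_le_mul_of_nonneg_left h1 (H.nonneg_left y hy)
    _ = _ := by ring

theorem integrand_mono (H : IsHessianWeight m p) (hα : 0 ≤ α) (hm : MonotoneOn h (Ici 0))
    (h0 : ∀ t ∈ Ici (0:ℝ), 0 ≤ h t) (hm' : MonotoneOn h' (Ici 0))
    (hle : ∀ t ∈ Ici (0:ℝ), h t ≤ h' t) :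
    ∀ y ∈ Ici (0:ℝ), (m y * ∫ t in (0:ℝ)..y, p t * h t) ^ α
      ≤ (m y * ∫ t in (0:ℝ)..y, p t * h' t) ^ α := fun y hy =>
  Real.rpow_le_rpow (H.base_nonneg h0 y hy) (mul_le_mul_of_nonneg_left
    (intervalIntegral.integral_mono_on hy (H.intervalIntegrable_mul hm y hy)
      (H.intervalIntegrable_mul hm' y hy) fun t ht =>
        mul_le_mul_of_nonneg_left (hle t ht.1) (H.nonneg_right t ht.1))
    (H.nonneg_left y hy)) hα

theorem intervalIntegrable_integrand (H : IsHessianWeight m p) (hα : 0 ≤ α)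
    (hm : MonotoneOn h (Ici 0)) (h0 : ∀ t ∈ Ici (0:ℝ), 0 ≤ h t) :
    ∀ r ∈ Ici (0:ℝ),
      IntervalIntegrable (fun y => (m y * ∫ t in (0:ℝ)..y, p t * h t) ^ α) volume 0 r := by
  intro r hr
  refine (((H.continuousOn_profile hα).intervalIntegrable_Ici r hr).const_mul (h r ^ α)).mono_fun
    ?_ ?_
  · rw [uIoc_of_le hr]
    have hc : ContinuousOn (fun y => (m y * ∫ t in (0:ℝ)..y, p t * h t) ^ α) (Ioi 0) :=
      (H.continuousOn_left.mul ((continuousOn_primitive_Ici (H.intervalIntegrable_mul hm)).mono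
        Ioi_subset_Ici_self)).rpow_const fun _ _ => Or.inr hα
    exact (hc.mono Ioc_subset_Ioi_self).aestronglyMeasurable measurableSet_Ioc
  · rw [uIoc_of_le hr]
    filter_upwards [ae_restrict_mem measurableSet_Ioc] with y hy
    have hy0 : y ∈ Ici (0:ℝ) := hy.1.le
    rw [Real.norm_of_nonneg (Real.rpow_nonneg (H.base_nonneg h0 y hy0) _), Real.norm_of_nonneg
      (mul_nonneg (Real.rpow_nonneg (h0 r hr) _) (H.profile_nonneg y hy0))]
    exact (H.integrand_le hα hm h0 y hy0).trans <| mul_le_mul_of_nonneg_right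
      (Real.rpow_le_rpow (h0 y hy0) (hm hy0 hr hy.2) hα) (H.profile_nonneg y hy0)

theorem monotoneOn_integral (H : IsHessianWeight m p) (hα : 0 ≤ α)
    (hm : MonotoneOn h (Ici 0)) (h0 : ∀ t ∈ Ici (0:ℝ), 0 ≤ h t) :
    MonotoneOn (fun r => ∫ y in (0:ℝ)..r, (m y * ∫ t in (0:ℝ)..y, p t * h t) ^ α) (Ici 0) :=
  monotoneOn_primitive_Ici (H.intervalIntegrable_integrand hα hm h0) fun y hy =>
    Real.rpow_nonneg (H.base_nonneg h0 y hy) _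

theorem integral_nonneg (H : IsHessianWeight m p) (h0 : ∀ t ∈ Ici (0:ℝ), 0 ≤ h t) :
    ∀ r ∈ Ici (0:ℝ), 0 ≤ ∫ y in (0:ℝ)..r, (m y * ∫ t in (0:ℝ)..y, p t * h t) ^ α := fun _ hr =>
  intervalIntegral.integral_nonneg hr fun y hy => Real.rpow_nonneg (H.base_nonneg h0 y hy.1) _

theorem integral_mono (H : IsHessianWeight m p) (hα : 0 ≤ α) (hm : MonotoneOn h (Ici 0))
    (h0 : ∀ t ∈ Ici (0:ℝ), 0 ≤ h t) (hm' : MonotoneOn h' (Ici 0))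
    (hle : ∀ t ∈ Ici (0:ℝ), h t ≤ h' t) :
    ∀ r ∈ Ici (0:ℝ), ∫ y in (0:ℝ)..r, (m y * ∫ t in (0:ℝ)..y, p t * h t) ^ α
      ≤ ∫ y in (0:ℝ)..r, (m y * ∫ t in (0:ℝ)..y, p t * h' t) ^ α := fun r hr =>
  intervalIntegral.integral_mono_on hr (H.intervalIntegrable_integrand hα hm h0 r hr)
    (H.intervalIntegrable_integrand hα hm' (fun t ht => (h0 t ht).trans (hle t ht)) r hr)
    fun y hy => H.integrand_mono hα hm h0 hm' hle y hy.1

end IsHessianWeight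

theorem MonotoneOn.exists_tendsto_atTop_of_le {u : ℝ → ℝ} {M : ℝ} (hu : MonotoneOn u (Ici 0))
    (hM : ∀ r ∈ Ici (0:ℝ), u r ≤ M) : ∃ L : ℝ, Tendsto u atTop (nhds L) := by
  have hmono : Monotone fun r => u (max r 0) := fun r s hrs =>
    hu (le_max_right r 0) (le_max_right s 0) (max_le_max_right 0 hrs)
  refine ⟨_, (tendsto_atTop_ciSup hmono
    ⟨M, by rintro _ ⟨r, rfl⟩; exact hM _ (le_max_right r 0)⟩).congr' ?_⟩
  filter_upwards [eventually_ge_atTop (0:ℝ)] with r hr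
  rw [max_eq_left hr]

/-- If both weights are admissible and the scalar comparison equation has a global bounded
solution, then the integral system has a bounded solution. -/
theorem exists_bounded_isRadialSolution {k₁ k₂ : ℕ} {a₁ a₂ : ℝ}
    {m₁ p₁ m₂ p₂ : ℝ → ℝ} {f₁ f₂ : ℝ → ℝ → ℝ}
    (H₁ : IsHessianWeight m₁ p₁) (H₂ : IsHessianWeight m₂ p₂) (ha₁ : 0 ≤ a₁) (ha₂ : 0 ≤ a₂)
    (hf₁c : ContinuousOn (fun q : ℝ × ℝ => f₁ q.1 q.2) (Ici 0 ×ˢ Ici 0))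
    (hf₂c : ContinuousOn (fun q : ℝ × ℝ => f₂ q.1 q.2) (Ici 0 ×ˢ Ici 0))
    (hf₁0 : ∀ x ∈ Ici (0:ℝ), ∀ y ∈ Ici (0:ℝ), 0 ≤ f₁ x y)
    (hf₂0 : ∀ x ∈ Ici (0:ℝ), ∀ y ∈ Ici (0:ℝ), 0 ≤ f₂ x y)
    (hf₁mono : ∀ x xQ y yQ : ℝ, 0 ≤ x → x ≤ xQ → 0 ≤ y → y ≤ yQ → f₁ x y ≤ f₁ xQ yQ)
    (hf₂mono : ∀ x xQ y yQ : ℝ, 0 ≤ x → x ≤ xQ → 0 ≤ y → y ≤ yQ → f₂ x y ≤ f₂ xQ yQ)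
    {W : ℝ → ℝ} {M : ℝ} (hWc : ContinuousOn W (Ici 0)) (hWa : ∀ r ∈ Ici (0:ℝ), a₁ + a₂ ≤ W r)
    (hW : ∀ r ∈ Ici (0:ℝ), W r = a₁ + a₂ + ∫ t in (0:ℝ)..r,
      (f₁ (W t) (W t) ^ (1/(k₁:ℝ)) + f₂ (W t) (W t) ^ (1/(k₂:ℝ))) *
      ((m₁ t * ∫ s in (0:ℝ)..t, p₁ s) ^ (1/(k₁:ℝ)) + (m₂ t * ∫ s in (0:ℝ)..t, p₂ s) ^ (1/(k₂:ℝ))))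
    (hWM : ∀ r ∈ Ici (0:ℝ), W r ≤ M) :
    ∃ u₁ u₂ : ℝ → ℝ,
      IsRadialSolution k₁ k₂ a₁ a₂ m₁ p₁ m₂ p₂ f₁ f₂ u₁ u₂ ∧
      (∃ L₁ : ℝ, Tendsto u₁ atTop (nhds L₁)) ∧
      (∃ L₂ : ℝ, Tendsto u₂ atTop (nhds L₂)) ∧
      ∀ r ∈ Ici (0:ℝ), u₁ r + u₂ r ≤ M := by
  have hα₁ : (0:ℝ) ≤ 1/(k₁:ℝ) := by positivity
  have hα₂ : (0:ℝ) ≤ 1/(k₂:ℝ) := by positivity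
  have hWmem : ∀ r ∈ Ici (0:ℝ), W r ∈ Ici (0:ℝ) := fun r hr =>
    (add_nonneg ha₁ ha₂).trans (hWa r hr)
  have mono_comp : ∀ {f : ℝ → ℝ → ℝ},
      (∀ x xQ y yQ : ℝ, 0 ≤ x → x ≤ xQ → 0 ≤ y → y ≤ yQ → f x y ≤ f xQ yQ) →
      ∀ {v₁ v₂ : ℝ → ℝ}, IsMonotonePair a₁ a₂ v₁ v₂ →
      MonotoneOn (fun t => f (v₁ t) (v₂ t)) (Ici 0) := fun hf v₁ v₂ hv r hr s hs hrs =>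
    hf _ _ _ _ (ha₁.trans (hv.le₁ r hr)) (hv.mono₁ hr hs hrs)
      (ha₂.trans (hv.le₂ r hr)) (hv.mono₂ hr hs hrs)
  have nonneg_comp : ∀ {f : ℝ → ℝ → ℝ}, (∀ x ∈ Ici (0:ℝ), ∀ y ∈ Ici (0:ℝ), 0 ≤ f x y) →
      ∀ {v₁ v₂ : ℝ → ℝ}, IsMonotonePair a₁ a₂ v₁ v₂ →
      ∀ t ∈ Ici (0:ℝ), 0 ≤ f (v₁ t) (v₂ t) := fun hf v₁ v₂ hv t ht =>
    hf _ (ha₁.trans (hv.le₁ t ht)) _ (ha₂.trans (hv.le₂ t ht))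
  set Q₁ : ℝ → ℝ := fun t => (m₁ t * ∫ s in (0:ℝ)..t, p₁ s) ^ (1/(k₁:ℝ)) with hQ₁
  set Q₂ : ℝ → ℝ := fun t => (m₂ t * ∫ s in (0:ℝ)..t, p₂ s) ^ (1/(k₂:ℝ)) with hQ₂
  set G₁ : ℝ → ℝ := fun t => f₁ (W t) (W t) ^ (1/(k₁:ℝ)) with hG₁
  set G₂ : ℝ → ℝ := fun t => f₂ (W t) (W t) ^ (1/(k₂:ℝ)) with hG₂
  have hQ₁c : ContinuousOn Q₁ (Ici 0) := H₁.continuousOn_profile hα₁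
  have hQ₂c : ContinuousOn Q₂ (Ici 0) := H₂.continuousOn_profile hα₂
  have hQ₁0 : ∀ t ∈ Ici (0:ℝ), 0 ≤ Q₁ t := H₁.profile_nonneg
  have hQ₂0 : ∀ t ∈ Ici (0:ℝ), 0 ≤ Q₂ t := H₂.profile_nonneg
  have hdiag : ContinuousOn (fun t => (W t, W t)) (Ici 0) := hWc.prodMk hWc
  have hmaps : MapsTo (fun t => (W t, W t)) (Ici 0) (Ici (0:ℝ) ×ˢ Ici (0:ℝ)) := fun t ht =>
    ⟨hWmem t ht, hWmem t ht⟩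
  have hG₁c : ContinuousOn G₁ (Ici 0) :=
    (hf₁c.comp hdiag hmaps).rpow_const fun _ _ => Or.inr hα₁
  have hG₂c : ContinuousOn G₂ (Ici 0) :=
    (hf₂c.comp hdiag hmaps).rpow_const fun _ _ => Or.inr hα₂
  have hG₁0 : ∀ t ∈ Ici (0:ℝ), 0 ≤ G₁ t := fun t ht =>
    Real.rpow_nonneg (hf₁0 _ (hWmem t ht) _ (hWmem t ht)) _
  have hG₂0 : ∀ t ∈ Ici (0:ℝ), 0 ≤ G₂ t := fun t ht =>
    Real.rpow_nonneg (hf₂0 _ (hWmem t ht) _ (hWmem t ht)) _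
  have hi₁ : ∀ x ∈ Ici (0:ℝ), IntervalIntegrable (fun t => G₁ t * Q₁ t) volume 0 x :=
    (hG₁c.mul hQ₁c).intervalIntegrable_Ici
  have hi₂ : ∀ x ∈ Ici (0:ℝ), IntervalIntegrable (fun t => G₂ t * Q₂ t) volume 0 x :=
    (hG₂c.mul hQ₂c).intervalIntegrable_Ici
  let W₁ : ℝ → ℝ := fun r => a₁ + ∫ t in (0:ℝ)..r, G₁ t * Q₁ t
  let W₂ : ℝ → ℝ := fun r => a₂ + ∫ t in (0:ℝ)..r, G₂ t * Q₂ t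
  have hWp : IsMonotonePair a₁ a₂ W₁ W₂ :=
    ⟨(monotoneOn_primitive_Ici hi₁ fun t ht => mul_nonneg (hG₁0 t ht) (hQ₁0 t ht)).const_add a₁,
      (monotoneOn_primitive_Ici hi₂ fun t ht => mul_nonneg (hG₂0 t ht) (hQ₂0 t ht)).const_add a₂,
      fun r hr => le_add_of_nonneg_right <| intervalIntegral.integral_nonneg hr fun t ht =>
        mul_nonneg (hG₁0 t ht.1) (hQ₁0 t ht.1),
      fun r hr => le_add_of_nonneg_right <| intervalIntegral.integral_nonneg hr fun t ht =>
        mul_nonneg (hG₂0 t ht.1) (hQ₂0 t ht.1)⟩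
  have hWsum : ∀ r ∈ Ici (0:ℝ), W₁ r + W₂ r ≤ W r := fun r hr => by
    have h1 : ∫ t in (0:ℝ)..r, (G₁ t * Q₁ t + G₂ t * Q₂ t)
        ≤ ∫ t in (0:ℝ)..r, (G₁ t + G₂ t) * (Q₁ t + Q₂ t) := by
      refine intervalIntegral.integral_mono_on hr ((hi₁ r hr).add (hi₂ r hr))
        (((hG₁c.add hG₂c).mul (hQ₁c.add hQ₂c)).intervalIntegrable_Ici r hr) fun t ht => ?_
      nlinarith [mul_nonneg (hG₁0 t ht.1) (hQ₂0 t ht.1), mul_nonneg (hG₂0 t ht.1) (hQ₁0 t ht.1)]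
    rw [intervalIntegral.integral_add (hi₁ r hr) (hi₂ r hr)] at h1
    rw [hW r hr]
    simp only [W₁, W₂]
    linarith
  have hW₁le : ∀ r ∈ Ici (0:ℝ), W₁ r ≤ W r := fun r hr => by
    linarith [hWsum r hr, hWp.le₂ r hr]
  have hW₂le : ∀ r ∈ Ici (0:ℝ), W₂ r ≤ W r := fun r hr => by
    linarith [hWsum r hr, hWp.le₁ r hr]
  have super : ∀ {m p : ℝ → ℝ} {f : ℝ → ℝ → ℝ} {α : ℝ}, 0 ≤ α → IsHessianWeight m p →
      (∀ x ∈ Ici (0:ℝ), ∀ y ∈ Ici (0:ℝ), 0 ≤ f x y) →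
      (∀ x xQ y yQ : ℝ, 0 ≤ x → x ≤ xQ → 0 ≤ y → y ≤ yQ → f x y ≤ f xQ yQ) →
      (∀ x ∈ Ici (0:ℝ), IntervalIntegrable
        (fun t => f (W t) (W t) ^ α * (m t * ∫ s in (0:ℝ)..t, p s) ^ α) volume 0 x) →
      ∀ r ∈ Ici (0:ℝ), ∫ y in (0:ℝ)..r, (m y * ∫ t in (0:ℝ)..y, p t * f (W₁ t) (W₂ t)) ^ α
        ≤ ∫ t in (0:ℝ)..r, f (W t) (W t) ^ α * (m t * ∫ s in (0:ℝ)..t, p s) ^ α := by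
    intro m p f α hα H hf0 hfm hi r hr
    have hm := mono_comp hfm hWp
    have h0 := nonneg_comp hf0 hWp
    refine intervalIntegral.integral_mono_on hr (H.intervalIntegrable_integrand hα hm h0 r hr)
      (hi r hr) fun y hy => (H.integrand_le hα hm h0 y hy.1).trans ?_
    refine mul_le_mul_of_nonneg_right (Real.rpow_le_rpow (h0 y hy.1) ?_ hα)
      (H.profile_nonneg y hy.1)
    exact hfm _ _ _ _ (ha₁.trans (hWp.le₁ y hy.1)) (hW₁le y hy.1)
      (ha₂.trans (hWp.le₂ y hy.1)) (hW₂le y hy.1)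
  obtain ⟨u₁, u₂, hu, huW, hfix⟩ := IsMonotonePair.exists_fixedPoint (a₁ := a₁) (a₂ := a₂)
    (T₁ := fun v₁ v₂ r => a₁ + ∫ y in (0:ℝ)..r,
      (m₁ y * ∫ t in (0:ℝ)..y, p₁ t * f₁ (v₁ t) (v₂ t)) ^ (1/(k₁:ℝ)))
    (T₂ := fun v₁ v₂ r => a₂ + ∫ y in (0:ℝ)..r,
      (m₂ y * ∫ t in (0:ℝ)..y, p₂ t * f₂ (v₁ t) (v₂ t)) ^ (1/(k₂:ℝ)))
    (fun v₁ v₂ hv =>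
      ⟨(H₁.monotoneOn_integral hα₁ (mono_comp hf₁mono hv) (nonneg_comp hf₁0 hv)).const_add a₁,
        (H₂.monotoneOn_integral hα₂ (mono_comp hf₂mono hv) (nonneg_comp hf₂0 hv)).const_add a₂,
        fun r hr => le_add_of_nonneg_right (H₁.integral_nonneg (nonneg_comp hf₁0 hv) r hr),
        fun r hr => le_add_of_nonneg_right (H₂.integral_nonneg (nonneg_comp hf₂0 hv) r hr)⟩)
    (fun v₁ v₂ w₁ w₂ hv hw hle r hr =>
      ⟨add_le_add_right (H₁.integral_mono hα₁ (mono_comp hf₁mono hv) (nonneg_comp hf₁0 hv)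
          (mono_comp hf₁mono hw) (fun t ht => hf₁mono _ _ _ _ (ha₁.trans (hv.le₁ t ht))
            (hle t ht).1 (ha₂.trans (hv.le₂ t ht)) (hle t ht).2) r hr) a₁,
        add_le_add_right (H₂.integral_mono hα₂ (mono_comp hf₂mono hv) (nonneg_comp hf₂0 hv)
          (mono_comp hf₂mono hw) (fun t ht => hf₂mono _ _ _ _ (ha₁.trans (hv.le₁ t ht))
            (hle t ht).1 (ha₂.trans (hv.le₂ t ht)) (hle t ht).2) r hr) a₂⟩)
    hWp
    (fun r hr => ⟨add_le_add_right (super hα₁ H₁ hf₁0 hf₁mono hi₁ r hr) a₁,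
      add_le_add_right (super hα₂ H₂ hf₂0 hf₂mono hi₂ r hr) a₂⟩)
  have hsum : ∀ r ∈ Ici (0:ℝ), u₁ r + u₂ r ≤ M := fun r hr =>
    (add_le_add (huW r hr).1 (huW r hr).2).trans ((hWsum r hr).trans (hWM r hr))
  refine ⟨u₁, u₂, ⟨?_, ?_, fun r hr => (hfix r hr).1, fun r hr => (hfix r hr).2⟩,
    hu.mono₁.exists_tendsto_atTop_of_le (M := M) fun r hr => ?_,
    hu.mono₂.exists_tendsto_atTop_of_le (M := M) fun r hr => ?_, hsum⟩
  · exact (continuousOn_const.add (continuousOn_primitive_Ici (H₁.intervalIntegrable_integrand hα₁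
      (mono_comp hf₁mono hu) (nonneg_comp hf₁0 hu)))).congr fun r hr => (hfix r hr).1
  · exact (continuousOn_const.add (continuousOn_primitive_Ici (H₂.intervalIntegrable_integrand hα₂
      (mono_comp hf₂mono hu) (nonneg_comp hf₂0 hu)))).congr fun r hr => (hfix r hr).2
  · linarith [hsum r hr, hu.le₂ r hr]
  · linarith [hsum r hr, hu.le₁ r hr]

/-- Theorem 1, Case 1: if `F(∞) = ∞` and `P₁(∞) + P₂(∞) < ∞`, then there is a radial
solution with central value `(a₁, a₂)` whose components have finite limits at infinity;
in fact `u₁(r) + u₂(r) ≤ F⁻¹(P₁(∞) + P₂(∞))` for all `r ≥ 0`. -/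
theorem hessian_system_bounded_solution_of_P_finite
    (N k₁ k₂ : ℕ) (hN : 3 ≤ N) (hk₁ : 1 ≤ k₁) (hk₁N : k₁ ≤ N) (hk₂ : 1 ≤ k₂) (hk₂N : k₂ ≤ N)
    (b₁ b₂ p₁ p₂ : ℝ → ℝ)
    (hb₁c : ContinuousOn b₁ (Set.Ici 0)) (hb₂c : ContinuousOn b₂ (Set.Ici 0))
    (hp₁c : ContinuousOn p₁ (Set.Ici 0)) (hp₂c : ContinuousOn p₂ (Set.Ici 0))
    (hb₁0 : ∀ t ∈ Set.Ici (0:ℝ), 0 ≤ b₁ t) (hb₂0 : ∀ t ∈ Set.Ici (0:ℝ), 0 ≤ b₂ t)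
    (hp₁0 : ∀ t ∈ Set.Ici (0:ℝ), 0 ≤ p₁ t) (hp₂0 : ∀ t ∈ Set.Ici (0:ℝ), 0 ≤ p₂ t)
    (C₀ C₀₀ : ℝ)
    (hC₀ : C₀ = (Nat.factorial (N-1) : ℝ) / ((Nat.factorial k₁ : ℝ) * (Nat.factorial (N - k₁) : ℝ)))
    (hC₀₀ : C₀₀ = (Nat.factorial (N-1) : ℝ) / ((Nat.factorial k₂ : ℝ) * (Nat.factorial (N - k₂) : ℝ)))
    (B₁m B₁p B₂m B₂p : ℝ → ℝ)
    (hB₁m : ∀ ξ : ℝ, B₁m ξ = ξ ^ ((k₁ : ℤ) - (N : ℤ)) / C₀ *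
      Real.exp (-(∫ t in (0:ℝ)..ξ, (1 / C₀) * t ^ (k₁ - 1) * b₁ t)))
    (hB₁p : ∀ ξ : ℝ, B₁p ξ = ξ ^ (N - 1) *
      Real.exp (∫ t in (0:ℝ)..ξ, (1 / C₀) * t ^ (k₁ - 1) * b₁ t) * p₁ ξ)
    (hB₂m : ∀ ξ : ℝ, B₂m ξ = ξ ^ ((k₂ : ℤ) - (N : ℤ)) / C₀₀ *
      Real.exp (-(∫ t in (0:ℝ)..ξ, (1 / C₀₀) * t ^ (k₂ - 1) * b₂ t)))
    (hB₂p : ∀ ξ : ℝ, B₂p ξ = ξ ^ (N - 1) *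
      Real.exp (∫ t in (0:ℝ)..ξ, (1 / C₀₀) * t ^ (k₂ - 1) * b₂ t) * p₂ ξ)
    (a₁ a₂ : ℝ) (ha₁ : 0 ≤ a₁) (ha₂ : 0 ≤ a₂) (ha : 0 < a₁ + a₂)
    (f₁ f₂ : ℝ → ℝ → ℝ)
    (hf₁c : ContinuousOn (fun q : ℝ × ℝ => f₁ q.1 q.2) (Set.Ici 0 ×ˢ Set.Ici 0))
    (hf₂c : ContinuousOn (fun q : ℝ × ℝ => f₂ q.1 q.2) (Set.Ici 0 ×ˢ Set.Ici 0))
    (hf₁0 : ∀ x ∈ Set.Ici (0:ℝ), ∀ y ∈ Set.Ici (0:ℝ), 0 ≤ f₁ x y)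
    (hf₂0 : ∀ x ∈ Set.Ici (0:ℝ), ∀ y ∈ Set.Ici (0:ℝ), 0 ≤ f₂ x y)
    (hf₁mono : ∀ x xQ y yQ : ℝ, 0 ≤ x → x ≤ xQ → 0 ≤ y → y ≤ yQ → f₁ x y ≤ f₁ xQ yQ)
    (hf₂mono : ∀ x xQ y yQ : ℝ, 0 ≤ x → x ≤ xQ → 0 ≤ y → y ≤ yQ → f₂ x y ≤ f₂ xQ yQ)
    (P₁ P₂ : ℝ → ℝ)
    (hP₁ : ∀ r : ℝ, P₁ r = ∫ t in (0:ℝ)..r, (B₁m t * ∫ s in (0:ℝ)..t, B₁p s) ^ (1/(k₁:ℝ)))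
    (hP₂ : ∀ r : ℝ, P₂ r = ∫ t in (0:ℝ)..r, (B₂m t * ∫ s in (0:ℝ)..t, B₂p s) ^ (1/(k₂:ℝ)))
    (F : ℝ → ℝ)
    (hF : ∀ r : ℝ, F r = ∫ t in (a₁+a₂)..r, 1 / (f₁ t t ^ (1/(k₁:ℝ)) + f₂ t t ^ (1/(k₂:ℝ))))
    (hfpos : ∀ t : ℝ, a₁ + a₂ ≤ t → 0 < f₁ t t ^ (1/(k₁:ℝ)) + f₂ t t ^ (1/(k₂:ℝ)))
    (hFinfty : Tendsto F atTop atTop)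
    (P₁lim P₂lim : ℝ)
    (hP₁lim : Tendsto P₁ atTop (nhds P₁lim)) (hP₂lim : Tendsto P₂ atTop (nhds P₂lim))
    (Finv : ℝ → ℝ) (hFinv : ∀ s : ℝ, a₁ + a₂ ≤ s → Finv (F s) = s) :
    ∃ u₁ u₂ : ℝ → ℝ,
      IsRadialSolution k₁ k₂ a₁ a₂ B₁m B₁p B₂m B₂p f₁ f₂ u₁ u₂ ∧
      (∃ L₁ : ℝ, Tendsto u₁ atTop (nhds L₁)) ∧
      (∃ L₂ : ℝ, Tendsto u₂ atTop (nhds L₂)) ∧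
      ∀ r ∈ Set.Ici (0:ℝ), u₁ r + u₂ r ≤ Finv (P₁lim + P₂lim) := by
  have hC₀pos : 0 < C₀ := by rw [hC₀]; positivity
  have hC₀₀pos : 0 < C₀₀ := by rw [hC₀₀]; positivity
  have H₁ : IsHessianWeight B₁m B₁p :=
    isHessianWeight_of_formula hk₁ hC₀pos (by omega) hb₁c hp₁c hb₁0 hp₁0 hB₁m hB₁p
  have H₂ : IsHessianWeight B₂m B₂p :=
    isHessianWeight_of_formula hk₂ hC₀₀pos (by omega) hb₂c hp₂c hb₂0 hp₂0 hB₂m hB₂p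
  have hα₁ : (0:ℝ) ≤ 1/(k₁:ℝ) := by positivity
  have hα₂ : (0:ℝ) ≤ 1/(k₂:ℝ) := by positivity
  have hdiag : ContinuousOn (fun t : ℝ => (t, t)) (Ici (a₁ + a₂)) := by fun_prop
  have hmaps : MapsTo (fun t : ℝ => (t, t)) (Ici (a₁ + a₂)) (Ici (0:ℝ) ×ˢ Ici (0:ℝ)) :=
    fun t ht => ⟨ha.le.trans ht, ha.le.trans ht⟩
  have hQ₁c := H₁.continuousOn_profile hα₁
  have hQ₂c := H₂.continuousOn_profile hα₂
  obtain ⟨W, hWc, hWa, hW, hWF⟩ := exists_separable_solution_s1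
    (((hf₁c.comp hdiag hmaps).rpow_const fun _ _ => Or.inr hα₁).add
      ((hf₂c.comp hdiag hmaps).rpow_const fun _ _ => Or.inr hα₂)) hfpos
    (hQ₁c.add hQ₂c)
    (fun t ht => add_nonneg (H₁.profile_nonneg t ht) (H₂.profile_nonneg t ht)) hF hFinfty
  have hP₁le : ∀ r ∈ Ici (0:ℝ), P₁ r ≤ P₁lim := fun r hr =>
    ge_of_tendsto hP₁lim <| (eventually_ge_atTop r).mono fun s hs => by
      rw [hP₁, hP₁]
      exact monotoneOn_primitive_Ici hQ₁c.intervalIntegrable_Ici H₁.profile_nonneg hr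
        (hr.trans hs) hs
  have hP₂le : ∀ r ∈ Ici (0:ℝ), P₂ r ≤ P₂lim := fun r hr =>
    ge_of_tendsto hP₂lim <| (eventually_ge_atTop r).mono fun s hs => by
      rw [hP₂, hP₂]
      exact monotoneOn_primitive_Ici hQ₂c.intervalIntegrable_Ici H₂.profile_nonneg hr
        (hr.trans hs) hs
  refine exists_bounded_isRadialSolution H₁ H₂ ha₁ ha₂ hf₁c hf₂c hf₁0 hf₂0 hf₁mono hf₂mono
    hWc hWa hW fun r hr => ?_
  obtain ⟨s, hs, hFs, hWs⟩ := hWF r hr (P₁lim + P₂lim) <| by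
    have h := add_le_add (hP₁le r hr) (hP₂le r hr)
    rw [hP₁, hP₂, ← intervalIntegral.integral_add (hQ₁c.intervalIntegrable_Ici r hr)
      (hQ₂c.intervalIntegrable_Ici r hr)] at h
    exact h
  rwa [← hFs, hFinv s hs]
end
end
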